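/- arXiv:2004.11950 — 2 statements merged into one kernel-verified Lean document; each statement's English description precedes it below -/
import Mathlib

section
/- Let b > 0, let k ∈ ℂ with 0 < Im k < 1/(2b), and let x ∈ ℝ with x ≠ 0. Then the integral ∫_{−∞}^{∞} e^{2πipx} / (2cosh(2πbp) − 2cosh(2πbk)) dp converges and equals (i/(2b sinh(2πbk))) ( e^{−2πikx}/(1 − e^{2πx/b}) + e^{2πikx}/(1 − e^{−2πx/b}) ). -/
open Real MeasureTheory

namespace FFD
open Complex Set

/-- boundary integral over the rectangle `[-T,T] × [0,h]` -/
noncomputable def RI (f : ℂ → ℂ) (T h : ℝ) : ℂ :=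
  (∫ s : ℝ in (-T)..T, f (s : ℂ)) - (∫ s : ℝ in (-T)..T, f ((s : ℂ) + (h : ℂ) * I)) +
    I * (∫ y : ℝ in (0 : ℝ)..h, f ((T : ℂ) + (y : ℂ) * I)) -
    I * (∫ y : ℝ in (0 : ℝ)..h, f (-(T : ℂ) + (y : ℂ) * I))

def Rect (T h : ℝ) : Set ℂ := {z | -T ≤ z.re ∧ z.re ≤ T ∧ 0 ≤ z.im ∧ z.im ≤ h}

lemma edges {f : ℂ → ℂ} {T h : ℝ} {a : ℂ} (h0 : -T < a.re) (h1 : a.re < T) (h2 : 0 < a.im)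
    (h3 : a.im < h) (hf : ContinuousOn f (Rect T h \ {a})) :
    IntervalIntegrable (fun s : ℝ => f (s : ℂ)) volume (-T) T ∧
    IntervalIntegrable (fun s : ℝ => f ((s : ℂ) + (h : ℂ) * I)) volume (-T) T ∧
    IntervalIntegrable (fun y : ℝ => f ((T : ℂ) + (y : ℂ) * I)) volume 0 h ∧
    IntervalIntegrable (fun y : ℝ => f (-(T : ℂ) + (y : ℂ) * I)) volume 0 h := by
  have hT : -T ≤ T := by linarith
  have hh : 0 ≤ h := by linarith
  refine ⟨?_, ?_, ?_, ?_⟩ <;> apply ContinuousOn.intervalIntegrable <;>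
    (first | rw [uIcc_of_le hT] | rw [uIcc_of_le hh]) <;>
    refine hf.comp (Continuous.continuousOn (by fun_prop)) ?_ <;> intro s hs <;>
    simp only [mem_Icc] at hs <;> refine ⟨?_, ?_⟩ <;>
    (first
      | (simp only [Rect, mem_ofPred_eq]; simp; first | (constructor <;> linarith) | (refine ⟨?_, ?_, ?_⟩ <;> linarith))
      | (simp only [mem_singleton_iff]; intro hc; subst hc; simp at h0 h1 h2 h3))

lemma RI_add {f g : ℂ → ℂ} {T h : ℝ} {a : ℂ} (h0 : -T < a.re) (h1 : a.re < T) (h2 : 0 < a.im)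
    (h3 : a.im < h) (hf : ContinuousOn f (Rect T h \ {a})) (hg : ContinuousOn g (Rect T h \ {a})) :
    RI (fun z => f z + g z) T h = RI f T h + RI g T h := by
  obtain ⟨f1, f2, f3, f4⟩ := edges h0 h1 h2 h3 hf
  obtain ⟨g1, g2, g3, g4⟩ := edges h0 h1 h2 h3 hg
  simp only [RI]
  rw [intervalIntegral.integral_add f1 g1, intervalIntegral.integral_add f2 g2,
    intervalIntegral.integral_add f3 g3, intervalIntegral.integral_add f4 g4]
  ring

lemma RI_const_mul {f : ℂ → ℂ} {T h : ℝ} (c : ℂ) :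
    RI (fun z => c * f z) T h = c * RI f T h := by
  simp only [RI, intervalIntegral.integral_const_mul]
  ring

lemma RI_congr {f g : ℂ → ℂ} {T h : ℝ} {a : ℂ} (h0 : -T < a.re) (h1 : a.re < T) (h2 : 0 < a.im)
    (h3 : a.im < h) (hfg : ∀ z ∈ Rect T h, z ≠ a → f z = g z) : RI f T h = RI g T h := by
  have hT : -T ≤ T := by linarith
  have hh : 0 ≤ h := by linarith
  have e1 : (∫ s : ℝ in (-T)..T, f (s : ℂ)) = ∫ s : ℝ in (-T)..T, g (s : ℂ) := by
    apply intervalIntegral.integral_congr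
    intro s hs
    rw [uIcc_of_le hT] at hs
    apply hfg
    · simp [Rect, hs.1, hs.2, hh]
    · rintro rfl; simp at h2
  have e2 : (∫ s : ℝ in (-T)..T, f ((s : ℂ) + (h : ℂ) * I)) =
      ∫ s : ℝ in (-T)..T, g ((s : ℂ) + (h : ℂ) * I) := by
    apply intervalIntegral.integral_congr
    intro s hs
    rw [uIcc_of_le hT] at hs
    apply hfg
    · simp [Rect, hs.1, hs.2, hh]
    · rintro rfl; simp at h3
  have e3 : (∫ y : ℝ in (0 : ℝ)..h, f ((T : ℂ) + (y : ℂ) * I)) =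
      ∫ y : ℝ in (0 : ℝ)..h, g ((T : ℂ) + (y : ℂ) * I) := by
    apply intervalIntegral.integral_congr
    intro s hs
    rw [uIcc_of_le hh] at hs
    apply hfg
    · simp only [Rect, mem_ofPred_eq]; simp [hs.1, hs.2]; linarith
    · rintro rfl; simp at h1
  have e4 : (∫ y : ℝ in (0 : ℝ)..h, f (-(T : ℂ) + (y : ℂ) * I)) =
      ∫ y : ℝ in (0 : ℝ)..h, g (-(T : ℂ) + (y : ℂ) * I) := by
    apply intervalIntegral.integral_congr
    intro s hs
    rw [uIcc_of_le hh] at hs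
    apply hfg
    · simp only [Rect, mem_ofPred_eq]; simp [hs.1, hs.2]; linarith
    · rintro rfl; simp at h0
  simp only [RI, e1, e2, e3, e4]

lemma RI_zero {f : ℂ → ℂ} {T h : ℝ} (hT : -T ≤ T) (hh : 0 ≤ h)
    (hf : DifferentiableOn ℂ f (Rect T h)) : RI f T h = 0 := by
  have := integral_boundary_rect_eq_zero_of_differentiableOn f ⟨-T, 0⟩ ⟨T, h⟩ (hf.mono (by
    intro z hz
    simp only [mem_reProdIm, uIcc_of_le hT, uIcc_of_le hh, mem_Icc] at hz
    exact ⟨hz.1.1, hz.1.2, hz.2.1, hz.2.2⟩))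
  simpa [RI] using this

lemma log_neg_pos {w : ℂ} (hw : 0 < w.im) : Complex.log (-w) = Complex.log w - π * I := by
  simp [Complex.log, arg_neg_eq_arg_sub_pi_of_im_pos hw]; ring

lemma log_neg_neg {w : ℂ} (hw : w.im < 0) : Complex.log (-w) = Complex.log w + π * I := by
  simp [Complex.log, arg_neg_eq_arg_add_pi_of_im_neg hw]; ring

/-- primitive along an edge -/
lemma edge_log (u v : ℂ) (σ : ℂ) (hσ : σ = 1 ∨ σ = -1) (p q : ℝ)
    (hs : ∀ t : ℝ, t ∈ uIcc p q → σ * (u + t * v) ∈ slitPlane) :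
    v * ∫ t : ℝ in p..q, (u + t * v)⁻¹ = Complex.log (σ * (u + q * v)) -
      Complex.log (σ * (u + p * v)) := by
  rw [← intervalIntegral.integral_const_mul]
  have hne : ∀ t : ℝ, t ∈ uIcc p q → u + t * v ≠ 0 := by
    intro t ht h0
    have := hs t ht
    rw [h0] at this
    simp at this
  refine intervalIntegral.integral_eq_sub_of_hasDerivAt (f := fun t : ℝ =>
    Complex.log (σ * (u + t * v))) ?_ ?_
  · intro t ht
    have h1 : HasDerivAt (fun t : ℝ => σ * (u + t * v)) (σ * v) t := by
      have : HasDerivAt (fun t : ℝ => (t : ℂ)) 1 t := Complex.ofRealCLM.hasDerivAt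
      simpa using ((this.mul_const v).const_add u).const_mul σ
    have h2 := h1.clog_real (hs t ht)
    have e : v * (u + t * v)⁻¹ = σ * v / (σ * (u + t * v)) := by
      rcases hσ with rfl | rfl
      · rw [one_mul, one_mul, div_eq_mul_inv]
      · rw [neg_one_mul, neg_one_mul, neg_div_neg_eq, div_eq_mul_inv]
    rw [e]
    exact h2
  · apply ContinuousOn.intervalIntegrable
    refine continuousOn_const.mul (ContinuousOn.inv₀ (Continuous.continuousOn (by fun_prop)) hne)

lemma RI_inv {T h : ℝ} {a : ℂ} (h0 : -T < a.re) (h1 : a.re < T) (h2 : 0 < a.im)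
    (h3 : a.im < h) : RI (fun z => (z - a)⁻¹) T h = 2 * π * I := by
  have hT : -T ≤ T := by linarith
  have hh : 0 ≤ h := by linarith
  have e1 := edge_log (-a) 1 1 (Or.inl rfl) (-T) T (by
    intro t ht; right; simp; linarith)
  have e2 := edge_log (h * I - a) 1 1 (Or.inl rfl) (-T) T (by
    intro t ht; right; simp; intro hc; linarith)
  have e3 := edge_log (T - a) I 1 (Or.inl rfl) 0 h (by
    intro t ht; left; simp; linarith)
  have e4 := edge_log (-T - a) I (-1) (Or.inr rfl) 0 h (by
    intro t ht; left; simp; linarith)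
  have l1 := log_neg_pos (w := -T - a + h * I) (by simp; linarith)
  have l2 := log_neg_neg (w := -T - a) (by simp; linarith)
  simp only [one_mul, mul_one, neg_one_mul, ofReal_neg, ofReal_zero, zero_mul, add_zero] at e1 e2 e3 e4
  rw [l1, l2] at e4
  have c1 : ∀ s : ℝ, ((s : ℂ) - a)⁻¹ = (-a + s)⁻¹ := fun s => by congr 1; ring
  have c2 : ∀ s : ℝ, ((s : ℂ) + h * I - a)⁻¹ = (h * I - a + s)⁻¹ := fun s => by congr 1; ring
  have c3 : ∀ s : ℝ, ((T : ℂ) + s * I - a)⁻¹ = (T - a + s * I)⁻¹ := fun s => by congr 1; ring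
  have c4 : ∀ s : ℝ, (-(T : ℂ) + s * I - a)⁻¹ = (-T - a + s * I)⁻¹ := fun s => by congr 1; ring
  simp only [RI, c1, c2, c3, c4]
  rw [e1, e2, e3, e4]
  have d1 : (-a + T : ℂ) = T - a := by ring
  have d2 : (-a + -T : ℂ) = -T - a := by ring
  have d3 : (h * I - a + T : ℂ) = T - a + h * I := by ring
  have d4 : (h * I - a + -T : ℂ) = -T - a + h * I := by ring
  rw [d1, d2, d3, d4]
  ring

lemma rect_nhds {T h : ℝ} {a : ℂ} (h0 : -T < a.re) (h1 : a.re < T) (h2 : 0 < a.im)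
    (h3 : a.im < h) : Rect T h ∈ nhds a := by
  have : IsOpen {z : ℂ | -T < z.re ∧ z.re < T ∧ 0 < z.im ∧ z.im < h} := by
    refine (isOpen_lt continuous_const continuous_re).inter
      ((isOpen_lt continuous_re continuous_const).inter
      ((isOpen_lt continuous_const continuous_im).inter (isOpen_lt continuous_im continuous_const)))
  exact Filter.mem_of_superset (this.mem_nhds ⟨h0, h1, h2, h3⟩)
    fun z hz => ⟨hz.1.le, hz.2.1.le, hz.2.2.1.le, hz.2.2.2.le⟩

lemma RI_cauchy {g : ℂ → ℂ} {T h : ℝ} {a : ℂ} (h0 : -T < a.re) (h1 : a.re < T) (h2 : 0 < a.im)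
    (h3 : a.im < h) (hg : DifferentiableOn ℂ g (Rect T h)) :
    RI (fun z => g z / (z - a)) T h = 2 * π * I * g a := by
  have hd : DifferentiableOn ℂ (dslope g a) (Rect T h) :=
    (Complex.differentiableOn_dslope (rect_nhds h0 h1 h2 h3)).2 hg
  have hi : ContinuousOn (fun z => g a * (z - a)⁻¹) (Rect T h \ {a}) := by
    refine continuousOn_const.mul (ContinuousOn.inv₀ (Continuous.continuousOn (by fun_prop)) ?_)
    intro z hz
    exact sub_ne_zero.2 hz.2
  rw [RI_congr (g := fun z => dslope g a z + g a * (z - a)⁻¹) h0 h1 h2 h3,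
    RI_add h0 h1 h2 h3 (hd.continuousOn.mono sdiff_subset) hi, RI_zero (by linarith) (by linarith) hd,
    RI_const_mul, RI_inv h0 h1 h2 h3]
  · ring
  · intro z _ hz
    have := sub_ne_zero.2 hz
    rw [dslope_of_ne _ hz, slope_def_field]
    field_simp
    ring

/-- denominators with one simple zero -/
lemma RI_simple {N D : ℂ → ℂ} {D' : ℂ} {T h : ℝ} {a : ℂ} (h0 : -T < a.re) (h1 : a.re < T)
    (h2 : 0 < a.im) (h3 : a.im < h) (hN : Differentiable ℂ N) (hD : Differentiable ℂ D)
    (hDa : D a = 0) (hD' : HasDerivAt D D' a) (hD'0 : D' ≠ 0)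
    (hz : ∀ z ∈ Rect T h, D z = 0 → z = a) :
    RI (fun z => N z / D z) T h = 2 * π * I * (N a / D') := by
  have hs : dslope D a a = D' := by rw [dslope_same, hD'.deriv]
  have hd : DifferentiableOn ℂ (dslope D a) (Rect T h) :=
    (Complex.differentiableOn_dslope (rect_nhds h0 h1 h2 h3)).2 hD.differentiableOn
  have hmul : ∀ z, D z = (z - a) * dslope D a z := by
    intro z
    have := sub_smul_dslope D a z
    rw [smul_eq_mul, hDa, sub_zero] at this
    exact this.symm
  have hne : ∀ z ∈ Rect T h, dslope D a z ≠ 0 := by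
    intro z hzr h0'
    have hza := hz z hzr (by rw [hmul, h0', mul_zero])
    rw [hza, hs] at h0'
    exact hD'0 h0'
  rw [RI_congr (g := fun z => (N z / dslope D a z) / (z - a)) h0 h1 h2 h3,
    RI_cauchy (g := fun z => N z / dslope D a z) h0 h1 h2 h3 (hN.differentiableOn.div hd hne), hs]
  intro z _ _
  rw [hmul z, div_div, mul_comm]

/-- the denominator -/
noncomputable def Dn (b : ℝ) (k z : ℂ) : ℂ :=
  2 * Complex.cosh (2 * (π : ℂ) * (b : ℂ) * z) - 2 * Complex.cosh (2 * (π : ℂ) * (b : ℂ) * k)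

/-- the numerator -/
noncomputable def En (x : ℝ) (z : ℂ) : ℂ := Complex.exp (2 * (π : ℂ) * I * z * (x : ℂ))

lemma norm_En (x : ℝ) (z : ℂ) : ‖En x z‖ = Real.exp (-(2 * π * z.im * x)) := by
  rw [En, Complex.norm_exp]
  congr 1
  simp

lemma norm_En_le (x h : ℝ) (z : ℂ) (h0 : 0 ≤ z.im) (h1 : z.im ≤ h) :
    ‖En x z‖ ≤ Real.exp (2 * π * h * |x|) := by
  rw [norm_En]
  apply Real.exp_le_exp.2
  have h2 : -(z.im * x) ≤ h * |x| :=
    calc -(z.im * x) = z.im * (-x) := by ring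
      _ ≤ z.im * |x| := mul_le_mul_of_nonneg_left (neg_le_abs x) h0
      _ ≤ h * |x| := mul_le_mul_of_nonneg_right h1 (abs_nonneg x)
  have := mul_le_mul_of_nonneg_left h2 Real.two_pi_pos.le
  linarith

lemma two_cosh_ge (w : ℂ) : Real.exp |w.re| - 1 ≤ ‖2 * Complex.cosh w‖ := by
  have e : 2 * Complex.cosh w = Complex.exp w + Complex.exp (-w) := by
    rw [Complex.cosh]; ring
  rw [e]
  rcases le_total 0 w.re with h | h
  · rw [abs_of_nonneg h]
    have h1 := norm_sub_le_norm_add (Complex.exp w) (Complex.exp (-w))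
    rw [Complex.norm_exp, Complex.norm_exp] at h1
    have : Real.exp ((-w).re) ≤ 1 := by rw [Real.exp_le_one_iff]; simpa using h
    linarith
  · rw [abs_of_nonpos h]
    have h1 := norm_sub_le_norm_add (Complex.exp (-w)) (Complex.exp w)
    rw [Complex.norm_exp, Complex.norm_exp, add_comm (Complex.exp (-w))] at h1
    have : Real.exp (w.re) ≤ 1 := by rw [Real.exp_le_one_iff]; exact h
    rw [neg_re] at h1
    linarith

lemma Dn_lower (b : ℝ) (hb : 0 < b) (k : ℂ) : ∃ M R : ℝ, 0 < M ∧ 0 < R ∧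
    ∀ z : ℂ, R ≤ |z.re| → 1 + z.re ^ 2 ≤ M * ‖Dn b k z‖ := by
  set c : ℝ := 2 * π * b with hc
  have hc0 : 0 < c := by positivity
  set C : ℝ := 1 + ‖2 * Complex.cosh (2 * (π : ℂ) * (b : ℂ) * k)‖ with hC
  have hC0 : 0 < C := by positivity
  refine ⟨1 + 4 / c ^ 2, 1 + 4 * C / c ^ 2, by positivity, by positivity, ?_⟩
  intro z hz
  have h1 := two_cosh_ge (2 * (π : ℂ) * (b : ℂ) * z)
  have hre : (2 * (π : ℂ) * (b : ℂ) * z).re = c * z.re := by simp [hc]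
  rw [hre, abs_mul, abs_of_pos hc0] at h1
  have h2 := norm_sub_norm_le (2 * Complex.cosh (2 * (π : ℂ) * (b : ℂ) * z))
    (2 * Complex.cosh (2 * (π : ℂ) * (b : ℂ) * k))
  have h3 := Real.quadratic_le_exp_of_nonneg (x := c * |z.re|) (by positivity)
  set t := |z.re| with ht
  have ht2 : z.re ^ 2 = t ^ 2 := (sq_abs _).symm
  have hq : 4 * C / c ^ 2 ≤ t ^ 2 := by
    have : 0 < 4 * C / c ^ 2 := by positivity
    nlinarith
  have hq' : 4 * C ≤ c ^ 2 * t ^ 2 := by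
    rw [div_le_iff₀ (by positivity)] at hq; linarith
  have hct : 0 ≤ c * t := by positivity
  have hD : 1 + c ^ 2 * t ^ 2 / 4 ≤ ‖Dn b k z‖ := by
    rw [Dn]
    nlinarith
  rw [ht2]
  have hM : (1 + 4 / c ^ 2) * (1 + c ^ 2 * t ^ 2 / 4) ≤ (1 + 4 / c ^ 2) * ‖Dn b k z‖ :=
    mul_le_mul_of_nonneg_left hD (by positivity)
  refine le_trans ?_ hM
  have : (1 + 4 / c ^ 2) * (1 + c ^ 2 * t ^ 2 / 4) = 1 + t ^ 2 + 4 / c ^ 2 + c ^ 2 * t ^ 2 / 4 := by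
    field_simp; ring
  rw [this]
  have : 0 ≤ 4 / c ^ 2 + c ^ 2 * t ^ 2 / 4 := by positivity
  linarith

lemma Dn_zero (b : ℝ) (hb : 0 < b) (k : ℂ) (hk1 : 0 < k.im) (hk2 : k.im < 1 / (2 * b)) (z : ℂ)
    (h0 : 0 ≤ z.im) (h1 : z.im ≤ 1 / (2 * b)) (hz : Dn b k z = 0) : z = k := by
  have hb' : 0 < 2 * b := by linarith
  rw [lt_div_iff₀ hb'] at hk2
  rw [le_div_iff₀ hb'] at h1
  have hcos : Complex.cos (2 * (π : ℂ) * (b : ℂ) * z * I) =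
      Complex.cos (2 * (π : ℂ) * (b : ℂ) * k * I) := by
    rw [Complex.cos_mul_I, Complex.cos_mul_I]
    rw [Dn] at hz
    linear_combination hz / 2
  have hbc : (b : ℂ) ≠ 0 := by exact_mod_cast hb.ne'
  have hpc : (π : ℂ) ≠ 0 := by exact_mod_cast Real.pi_ne_zero
  have hkb : 0 < k.im * b := mul_pos hk1 hb
  have hzb : 0 ≤ z.im * b := mul_nonneg h0 hb.le
  obtain ⟨n, hn | hn⟩ := Complex.cos_eq_cos_iff.1 hcos
  · have hre := congrArg Complex.re hn
    simp at hre
    have hre' : (n : ℝ) = z.im * b - k.im * b := by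
      apply mul_left_cancel₀ Real.two_pi_pos.ne'
      linear_combination -hre
    have n1 : (n : ℝ) < 1 := by linarith
    have n2 : (-1 : ℝ) < n := by linarith
    have n1' : n < 1 := by exact_mod_cast n1
    have n2' : -1 < n := by exact_mod_cast n2
    have n0 : n = 0 := by omega
    subst n0
    simp [hbc, hpc] at hn
    exact hn.symm
  · have hre := congrArg Complex.re hn
    simp at hre
    have hre' : (n : ℝ) = -(z.im * b + k.im * b) := by
      apply mul_left_cancel₀ Real.two_pi_pos.ne'
      linear_combination -hre
    have n1 : (n : ℝ) < 0 := by linarith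
    have n2 : (-1 : ℝ) < n := by linarith
    have n1' : n < 0 := by exact_mod_cast n1
    have n2' : -1 < n := by exact_mod_cast n2
    omega

lemma sinh_ne (b : ℝ) (hb : 0 < b) (k : ℂ) (hk1 : 0 < k.im) (hk2 : k.im < 1 / (2 * b)) :
    Complex.sinh (2 * (π : ℂ) * (b : ℂ) * k) ≠ 0 := by
  intro h
  have hb' : 0 < 2 * b := by linarith
  rw [lt_div_iff₀ hb'] at hk2
  have hs : Complex.sin (2 * (π : ℂ) * (b : ℂ) * k * I) = 0 := by
    rw [Complex.sin_mul_I, h, zero_mul]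
  obtain ⟨n, hn⟩ := Complex.sin_eq_zero_iff.1 hs
  have hre := congrArg Complex.re hn
  simp at hre
  have hkb : 0 < k.im * b := mul_pos hk1 hb
  have hre' : (n : ℝ) = -(k.im * (2 * b)) := by
    apply mul_left_cancel₀ Real.pi_ne_zero
    linear_combination -hre
  have n1 : (n : ℝ) < 0 := by linarith
  have n2 : (-1 : ℝ) < n := by linarith
  have n1' : n < 0 := by exact_mod_cast n1
  have n2' : -1 < n := by exact_mod_cast n2
  omega

lemma line_integrable (b : ℝ) (hb : 0 < b) (k : ℂ) (x y : ℝ) (hy : 0 ≤ y)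
    (hne : ∀ s : ℝ, Dn b k ((s : ℂ) + (y : ℂ) * I) ≠ 0) :
    Integrable (fun s : ℝ => En x ((s : ℂ) + (y : ℂ) * I) / Dn b k ((s : ℂ) + (y : ℂ) * I)) := by
  obtain ⟨M, R, hM, hR, hl⟩ := Dn_lower b hb k
  have hcont : Continuous (fun s : ℝ =>
      En x ((s : ℂ) + (y : ℂ) * I) / Dn b k ((s : ℂ) + (y : ℂ) * I)) := by
    refine Continuous.div ?_ ?_ hne
    · unfold En; fun_prop
    · unfold Dn; fun_prop
  refine hcont.locallyIntegrable.integrable_of_isBigO_cocompact (g := fun s : ℝ => (1 + s ^ 2)⁻¹)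
    ?_ (integrable_inv_one_add_sq.integrableAtFilter _)
  refine Asymptotics.IsBigO.of_bound (Real.exp (2 * π * y * |x|) * M) ?_
  have hev : ∀ᶠ s : ℝ in Filter.cocompact ℝ, R ≤ |s| :=
    (tendsto_norm_cocompact_atTop (E := ℝ)).eventually (Filter.eventually_ge_atTop R)
  filter_upwards [hev] with s hs
  have h1 := hl ((s : ℂ) + (y : ℂ) * I) (by simpa using hs)
  have h2 := norm_En_le x y ((s : ℂ) + (y : ℂ) * I) (by simpa using hy) (by simp)
  have hre : ((s : ℂ) + (y : ℂ) * I).re = s := by simp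
  rw [hre] at h1
  have hp := norm_pos_iff.2 (hne s)
  have h3 : 0 < 1 + s ^ 2 := by positivity
  rw [norm_div, Real.norm_of_nonneg (inv_nonneg.2 h3.le), div_le_iff₀ hp]
  have h4 : 1 ≤ M * (1 + s ^ 2)⁻¹ * ‖Dn b k ((s : ℂ) + (y : ℂ) * I)‖ := by
    rw [mul_right_comm, ← div_eq_mul_inv, le_div_iff₀ h3, one_mul]; exact h1
  calc _ ≤ Real.exp (2 * π * y * |x|) * 1 := by rw [mul_one]; exact h2
    _ ≤ Real.exp (2 * π * y * |x|) * (M * (1 + s ^ 2)⁻¹ * ‖Dn b k ((s : ℂ) + (y : ℂ) * I)‖) :=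
      mul_le_mul_of_nonneg_left h4 (Real.exp_pos _).le
    _ = _ := by ring

lemma vert_bound (b : ℝ) (k : ℂ) (x h : ℝ) (hh : 0 ≤ h) (M R : ℝ) (hM : 0 < M)
    (hl : ∀ z : ℂ, R ≤ |z.re| → 1 + z.re ^ 2 ≤ M * ‖Dn b k z‖) (t : ℝ) (ht : R ≤ |t|) :
    ‖I * ∫ y : ℝ in (0 : ℝ)..h, En x ((t : ℂ) + (y : ℂ) * I) / Dn b k ((t : ℂ) + (y : ℂ) * I)‖ ≤
      Real.exp (2 * π * h * |x|) * M * h * (1 + t ^ 2)⁻¹ := by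
  rw [norm_mul, norm_I, one_mul]
  have := intervalIntegral.norm_integral_le_of_norm_le_const (a := 0) (b := h)
    (C := Real.exp (2 * π * h * |x|) * M * (1 + t ^ 2)⁻¹)
    (f := fun y : ℝ => En x ((t : ℂ) + (y : ℂ) * I) / Dn b k ((t : ℂ) + (y : ℂ) * I)) ?_
  · rw [sub_zero, abs_of_nonneg hh] at this
    linarith
  · intro y hy
    rw [uIoc_of_le hh] at hy
    have h1 := hl ((t : ℂ) + (y : ℂ) * I) (by simpa using ht)
    have h2 := norm_En_le x h ((t : ℂ) + (y : ℂ) * I) (by simpa using hy.1.le) (by simpa using hy.2)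
    have hre : ((t : ℂ) + (y : ℂ) * I).re = t := by simp
    rw [hre] at h1
    have h3 : 0 < 1 + t ^ 2 := by positivity
    have hp : 0 < ‖Dn b k ((t : ℂ) + (y : ℂ) * I)‖ := by
      by_contra hc
      nlinarith
    rw [norm_div, div_le_iff₀ hp]
    have h4 : 1 ≤ M * (1 + t ^ 2)⁻¹ * ‖Dn b k ((t : ℂ) + (y : ℂ) * I)‖ := by
      rw [mul_right_comm, ← div_eq_mul_inv, le_div_iff₀ h3, one_mul]; exact h1
    calc _ ≤ Real.exp (2 * π * h * |x|) * 1 := by rw [mul_one]; exact h2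
      _ ≤ Real.exp (2 * π * h * |x|) * (M * (1 + t ^ 2)⁻¹ * ‖Dn b k ((t : ℂ) + (y : ℂ) * I)‖) :=
        mul_le_mul_of_nonneg_left h4 (Real.exp_pos _).le
      _ = _ := by ring

lemma bottom_ne (b : ℝ) (hb : 0 < b) (k : ℂ) (hk1 : 0 < k.im) (hk2 : k.im < 1 / (2 * b))
    (y : ℝ) (hy : y = 0 ∨ y = 1 / (2 * b)) (s : ℝ) : Dn b k ((s : ℂ) + (y : ℂ) * I) ≠ 0 := by
  have hp : 0 < 1 / (2 * b) := by positivity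
  intro h
  have hi : ((s : ℂ) + (y : ℂ) * I).im = y := by simp
  have := Dn_zero b hb k hk1 hk2 _ (by rw [hi]; rcases hy with rfl | rfl <;> linarith)
    (by rw [hi]; rcases hy with rfl | rfl <;> linarith) h
  rw [← this, hi] at hk1 hk2
  rcases hy with rfl | rfl <;> linarith

lemma shift (b : ℝ) (hb : 0 < b) (k : ℂ) (hk1 : 0 < k.im) (hk2 : k.im < 1 / (2 * b)) (x : ℝ) :
    (∫ s : ℝ, En x s / Dn b k s) -
      (∫ s : ℝ, En x (s + ((1 / (2 * b) : ℝ) : ℂ) * I) / Dn b k (s + ((1 / (2 * b) : ℝ) : ℂ) * I)) =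
    2 * π * I * (En x k / (4 * π * b * Complex.sinh (2 * (π : ℂ) * (b : ℂ) * k))) := by
  obtain ⟨M, R, hM, hR, hl⟩ := Dn_lower b hb k
  have i0 := line_integrable b hb k x 0 le_rfl (bottom_ne b hb k hk1 hk2 0 (Or.inl rfl))
  simp only [ofReal_zero, zero_mul, add_zero] at i0
  have hh0 : 0 ≤ 1 / (2 * b) := by positivity
  have i1 := line_integrable b hb k x (1 / (2 * b)) hh0 (bottom_ne b hb k hk1 hk2 _ (Or.inr rfl))
  set h : ℝ := 1 / (2 * b) with hh
  have t1 := intervalIntegral_tendsto_integral i0 Filter.tendsto_neg_atTop_atBot Filter.tendsto_id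
  have t2 := intervalIntegral_tendsto_integral i1 Filter.tendsto_neg_atTop_atBot Filter.tendsto_id
  have tz : Filter.Tendsto (fun t : ℝ => Real.exp (2 * π * h * |x|) * M * h * (1 + t ^ 2)⁻¹)
      Filter.atTop (nhds 0) := by
    rw [← mul_zero (Real.exp (2 * π * h * |x|) * M * h)]
    refine Filter.Tendsto.const_mul _ (Filter.Tendsto.inv_tendsto_atTop ?_)
    exact Filter.tendsto_atTop_add_const_left _ _ (Filter.tendsto_pow_atTop two_ne_zero)
  have t3 : Filter.Tendsto (fun t : ℝ => I * ∫ y : ℝ in (0 : ℝ)..h,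
      En x ((t : ℂ) + (y : ℂ) * I) / Dn b k ((t : ℂ) + (y : ℂ) * I)) Filter.atTop (nhds 0) := by
    refine squeeze_zero_norm' ?_ tz
    filter_upwards [Filter.eventually_ge_atTop R] with t ht
    exact vert_bound b k x h hh0 M R hM hl t (ht.trans (le_abs_self t))
  have t4 : Filter.Tendsto (fun t : ℝ => I * ∫ y : ℝ in (0 : ℝ)..h,
      En x (-(t : ℂ) + (y : ℂ) * I) / Dn b k (-(t : ℂ) + (y : ℂ) * I)) Filter.atTop (nhds 0) := by
    refine squeeze_zero_norm' ?_ tz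
    filter_upwards [Filter.eventually_ge_atTop R] with t ht
    have := vert_bound b k x h hh0 M R hM hl (-t) (by rw [abs_neg]; exact ht.trans (le_abs_self t))
    simpa using this
  have tt := ((t1.sub t2).add t3).sub t4
  rw [add_zero, sub_zero] at tt
  refine tendsto_nhds_unique tt ?_
  refine Filter.Tendsto.congr' ?_ tendsto_const_nhds
  filter_upwards [Filter.eventually_gt_atTop |k.re|] with T hT
  have hT' := abs_lt.1 hT
  have hsin := sinh_ne b hb k hk1 hk2
  have hbc : (b : ℂ) ≠ 0 := by exact_mod_cast hb.ne'
  have hpc : (π : ℂ) ≠ 0 := by exact_mod_cast Real.pi_ne_zero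
  have key := RI_simple (N := En x) (D := Dn b k) (a := k)
    (D' := 4 * π * b * Complex.sinh (2 * (π : ℂ) * (b : ℂ) * k)) (T := T) (h := h)
    hT'.1 hT'.2 hk1 hk2 (by unfold En; fun_prop) (by unfold Dn; fun_prop) (by simp [Dn])
    (by
      have h1 : HasDerivAt (fun z : ℂ => 2 * (π : ℂ) * (b : ℂ) * z) (2 * (π : ℂ) * (b : ℂ)) k := by
        simpa using (hasDerivAt_id k).const_mul (2 * (π : ℂ) * (b : ℂ))
      have h2 := (h1.ccosh.const_mul 2).sub_const (2 * Complex.cosh (2 * (π : ℂ) * (b : ℂ) * k))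
      unfold Dn
      have e : 4 * π * b * Complex.sinh (2 * (π : ℂ) * (b : ℂ) * k) =
          2 * (Complex.sinh (2 * (π : ℂ) * (b : ℂ) * k) * (2 * (π : ℂ) * (b : ℂ))) := by ring
      rw [e]
      exact h2)
    (by simp [hsin, hbc])
    (fun z hz h0 => Dn_zero b hb k hk1 hk2 z hz.2.2.1 hz.2.2.2 h0)
  rw [← key]
  rfl

lemma top_eq (b : ℝ) (hb : 0 < b) (k : ℂ) (x : ℝ) :
    (∫ s : ℝ, En x (s + ((1 / (2 * b) : ℝ) : ℂ) * I) / Dn b k (s + ((1 / (2 * b) : ℝ) : ℂ) * I)) =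
    Complex.exp (-(π * x / b)) * ∫ s : ℝ, En x s / (-2 * Complex.cosh (2 * (π : ℂ) * (b : ℂ) * s) -
      2 * Complex.cosh (2 * (π : ℂ) * (b : ℂ) * k)) := by
  have hbc : (b : ℂ) ≠ 0 := by exact_mod_cast hb.ne'
  rw [← integral_const_mul]
  congr 1
  ext s
  have e1 : En x (s + ((1 / (2 * b) : ℝ) : ℂ) * I) = Complex.exp (-(π * x / b)) * En x s := by
    rw [En, En, ← Complex.exp_add]
    congr 1
    push_cast
    field_simp
    linear_combination (x : ℂ) * I_sq
  have e2 : 2 * (π : ℂ) * (b : ℂ) * (s + ((1 / (2 * b) : ℝ) : ℂ) * I) =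
      2 * (π : ℂ) * (b : ℂ) * s + π * I := by
    push_cast
    field_simp
  rw [e1, Dn, e2, Complex.cosh_add, Complex.cosh_mul_I, Complex.sinh_mul_I]
  simp
  ring

lemma even_int (D : ℂ → ℂ) (hD : ∀ z, D (-z) = D z) (x : ℝ) :
    (∫ s : ℝ, En (-x) s / D s) = ∫ s : ℝ, En x s / D s := by
  rw [← integral_neg_eq_self (fun s : ℝ => En x s / D s)]
  congr 1
  ext s
  push_cast
  rw [hD, En, En]
  push_cast
  congr 2
  ring

end FFD

/-- the integral kernel of the resolvent of the free functional-difference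
operator `H₀ = U + U⁻¹`: for `b > 0`, `0 < Im k < 1/(2b)` and real `x ≠ 0`,
`∫_{-∞}^∞ e^{2πipx}/(2cosh(2πbp) - 2cosh(2πbk)) dp`
converges and equals
`(i/(2b sinh(2πbk))) (e^{-2πikx}/(1 - e^{2πx/b}) + e^{2πikx}/(1 - e^{-2πx/b}))`. -/
theorem free_functional_difference_resolvent_kernel
    (b : ℝ) (hb : 0 < b) (k : ℂ) (hk1 : 0 < k.im) (hk2 : k.im < 1 / (2 * b))
    (x : ℝ) (hx : x ≠ 0) :
    Integrable (fun p : ℝ => Complex.exp (2 * (π : ℂ) * Complex.I * (p : ℂ) * (x : ℂ)) /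
      (2 * Complex.cosh (2 * (π : ℂ) * (b : ℂ) * (p : ℂ)) -
        2 * Complex.cosh (2 * (π : ℂ) * (b : ℂ) * k))) ∧
    (∫ p : ℝ, Complex.exp (2 * (π : ℂ) * Complex.I * (p : ℂ) * (x : ℂ)) /
      (2 * Complex.cosh (2 * (π : ℂ) * (b : ℂ) * (p : ℂ)) -
        2 * Complex.cosh (2 * (π : ℂ) * (b : ℂ) * k))) =
      Complex.I / (2 * (b : ℂ) * Complex.sinh (2 * (π : ℂ) * (b : ℂ) * k)) *
        (Complex.exp (-2 * (π : ℂ) * Complex.I * k * (x : ℂ)) /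
            (1 - Complex.exp (2 * (π : ℂ) * (x : ℂ) / (b : ℂ))) +
          Complex.exp (2 * (π : ℂ) * Complex.I * k * (x : ℂ)) /
            (1 - Complex.exp (-2 * (π : ℂ) * (x : ℂ) / (b : ℂ)))) := by
  constructor
  · have i0 := FFD.line_integrable b hb k x 0 le_rfl
      (FFD.bottom_ne b hb k hk1 hk2 0 (Or.inl rfl))
    simp only [Complex.ofReal_zero, zero_mul, add_zero] at i0
    exact i0
  · have hsin := FFD.sinh_ne b hb k hk1 hk2
    have hbc : (b : ℂ) ≠ 0 := by exact_mod_cast hb.ne'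
    have hpc : (π : ℂ) ≠ 0 := by exact_mod_cast Real.pi_ne_zero
    have s1 := FFD.shift b hb k hk1 hk2 x
    have s2 := FFD.shift b hb k hk1 hk2 (-x)
    rw [FFD.top_eq b hb k] at s1 s2
    rw [FFD.even_int (FFD.Dn b k) (by intro z; simp [FFD.Dn]) x,
      FFD.even_int (fun s => -2 * Complex.cosh (2 * (π : ℂ) * (b : ℂ) * s) -
      2 * Complex.cosh (2 * (π : ℂ) * (b : ℂ) * k)) (by intro z; simp) x] at s2
    change (∫ p : ℝ, FFD.En x p / FFD.Dn b k p) = _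
    generalize (∫ p : ℝ, FFD.En x p / FFD.Dn b k p) = A at *
    generalize (∫ s : ℝ, FFD.En x s / (-2 * Complex.cosh (2 * (π : ℂ) * (b : ℂ) * s) -
      2 * Complex.cosh (2 * (π : ℂ) * (b : ℂ) * k))) = K at *
    set S := Complex.sinh (2 * (π : ℂ) * (b : ℂ) * k) with hS
    have n1 : FFD.En (-x) k = Complex.exp (-2 * (π : ℂ) * Complex.I * k * (x : ℂ)) := by
      rw [FFD.En]; congr 1; push_cast; ring
    have n2 : FFD.En x k = Complex.exp (2 * (π : ℂ) * Complex.I * k * (x : ℂ)) := rfl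
    rw [n1] at s2
    rw [n2] at s1
    generalize Complex.exp (-2 * (π : ℂ) * Complex.I * k * (x : ℂ)) = u at *
    generalize Complex.exp (2 * (π : ℂ) * Complex.I * k * (x : ℂ)) = v at *
    have q1 : Complex.exp (2 * (π : ℂ) * (x : ℂ) / (b : ℂ)) = Complex.exp (π * x / b) ^ 2 := by
      rw [← Complex.exp_nat_mul]; congr 1; push_cast; ring
    have q2 : Complex.exp (-2 * (π : ℂ) * (x : ℂ) / (b : ℂ)) = (Complex.exp (π * x / b) ^ 2)⁻¹ := by
      rw [← q1, ← Complex.exp_neg]; congr 1; ring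
    have q3 : Complex.exp (-(π * x / b)) = (Complex.exp (π * x / b))⁻¹ := Complex.exp_neg _
    have q4 : Complex.exp (-(π * ((-x : ℝ) : ℂ) / b)) = Complex.exp (π * x / b) := by
      congr 1; push_cast; ring
    rw [q3] at s1
    rw [q4] at s2
    rw [q1, q2]
    have q5 : Complex.exp (π * x / b) ^ 2 ≠ 1 := by
      rw [← q1]
      have : (2 * (π : ℂ) * (x : ℂ) / (b : ℂ)) = ((2 * π * x / b : ℝ) : ℂ) := by push_cast; ring
      rw [this, ← Complex.ofReal_exp]
      intro hc
      have hc' : Real.exp (2 * π * x / b) = 1 := by exact_mod_cast hc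
      rw [Real.exp_eq_one_iff] at hc'
      have : 2 * π * x / b ≠ 0 := by
        have := Real.pi_ne_zero
        have := hb.ne'
        positivity
      exact this hc'
    have q6 : Complex.exp (π * x / b) ≠ 0 := Complex.exp_ne_zero _
    generalize Complex.exp (π * x / b) = q at *
    have q7 : 1 - q ^ 2 ≠ 0 := sub_ne_zero.2 q5.symm
    have q8 : 1 - (q ^ 2)⁻¹ = -(1 - q ^ 2) / q ^ 2 := by field_simp; ring
    rw [q8]
    have r : ∀ w : ℂ, 2 * (π : ℂ) * Complex.I * (w / (4 * π * b * S)) =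
        Complex.I / (2 * b * S) * w := by
      intro w; field_simp; ring
    rw [r] at s1 s2
    generalize Complex.I / (2 * b * S) = c at *
    have s1' : q * A - K = q * (c * v) := by
      rw [← s1]; field_simp
    field_simp
    linear_combination (-q) * s1' + s2
end

section
/- (Deuring) If there exist infinitely many squarefree integers d < 0 such that the class number of the imaginary quadratic field ℚ(√d) equals 1, then the Riemann hypothesis holds: every zero ρ of the Riemann zeta function ζ with 0 < Re ρ < 1 satisfies Re ρ = 1/2. -/
open Complex

theorem dz_int_of_sq {d M : ℤ} (hd : Squarefree d) {q : ℚ} (h : (d : ℚ) * q ^ 2 = M) :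
    ∃ B : ℤ, q = B := by
  have hden : (q.den : ℚ) ≠ 0 := by exact_mod_cast q.den_nz
  have h1 : (d : ℚ) * q.num ^ 2 = M * q.den ^ 2 := by
    have : q = q.num / q.den := (Rat.num_div_den q).symm
    rw [this] at h
    field_simp at h
    linarith
  have h2 : d * q.num ^ 2 = M * (q.den : ℤ) ^ 2 := by exact_mod_cast h1
  have hc : IsCoprime ((q.den : ℤ) ^ 2) (q.num ^ 2) := by
    apply IsCoprime.pow
    have := q.reduced
    rw [Int.isCoprime_iff_gcd_eq_one, Int.gcd_comm]
    simpa [Int.gcd, Nat.Coprime] using this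
  have h3 : (q.den : ℤ) ^ 2 ∣ d := hc.dvd_of_dvd_mul_right ⟨M, by rw [h2]; ring⟩
  have h4 : IsUnit (q.den : ℤ) := hd _ (by rwa [← sq])
  have h5 : q.den = 1 := by
    rcases Int.isUnit_iff.1 h4 with h | h <;> omega
  exact ⟨q.num, (Rat.den_eq_one_iff q).1 h5 |>.symm⟩

section
variable {d : ℤ}

abbrev DzK (d : ℤ) : Type := QuadraticAlgebra ℚ (d : ℚ) 0

theorem dz_fact (hd : d < 0) : Fact (∀ r : ℚ, r ^ 2 ≠ (d : ℚ) + 0 * r) := by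
  constructor
  intro r hr
  have : (d : ℚ) < 0 := by exact_mod_cast hd
  nlinarith [sq_nonneg r]

theorem dz_star_int {x : DzK d} (hx : IsIntegral ℤ x) : IsIntegral ℤ (star x) := by
  have := hx.map ((starRingEnd (DzK d)).toIntAlgHom)
  exact this

theorem dz_coords (hsq : Squarefree d) {x : DzK d} (hx : IsIntegral ℤ x) :
    (∃ A : ℤ, 2 * x.re = A) ∧ (∃ B : ℤ, 2 * x.im = B) ∧ ∃ N : ℤ, x.re ^ 2 - d * x.im ^ 2 = N := by
  have hs := dz_star_int hx
  have h1 : IsIntegral ℤ (algebraMap ℚ (DzK d) (2 * x.re)) := by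
    have := hx.add hs
    convert this using 1
    ext <;> simp
    ring
  have h2 : IsIntegral ℤ (algebraMap ℚ (DzK d) (x.re ^ 2 - d * x.im ^ 2)) := by
    have := hx.mul hs
    convert this using 1
    rw [QuadraticAlgebra.algebraMap_eq]
    ext <;> simp <;> ring
  rw [isIntegral_algebraMap_iff (algebraMap ℚ (DzK d)).injective] at h1 h2
  obtain ⟨A, hA⟩ := (IsIntegrallyClosed.isIntegral_iff).1 h1
  obtain ⟨N, hN⟩ := (IsIntegrallyClosed.isIntegral_iff).1 h2
  simp only [eq_intCast] at hA hN
  refine ⟨⟨A, hA.symm⟩, ?_, ⟨N, hN.symm⟩⟩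
  apply dz_int_of_sq (M := A ^ 2 - 4 * N) hsq
  push_cast
  rw [hA, hN]
  ring

theorem dz_key (hd : d < 0) (hsq : Squarefree d)
    (h : ∀ (K : Type) [Field K] [NumberField K], Module.finrank ℚ K = 2 →
          (∃ α : K, α ^ 2 = (d : K)) → NumberField.classNumber K = 1)
    (p : ℕ) (hp : p.Prime) (u v : ℚ) (hi : IsIntegral ℤ (⟨u, v⟩ : DzK d)) (m : ℤ)
    (hm : u ^ 2 - d * v ^ 2 = p * m) (hn : ¬ IsIntegral ℤ (⟨u / p, v / p⟩ : DzK d)) :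
    ∃ A B : ℤ, A ^ 2 - d * B ^ 2 = 4 * p := by
  have := dz_fact hd
  have : CharZero (DzK d) := inferInstance
  have halg : (QuadraticAlgebra.instAlgebra : Algebra ℚ (DzK d)) = DivisionRing.toRatAlgebra :=
    Subsingleton.elim _ _
  have : NumberField (DzK d) := { to_charZero := inferInstance, to_finiteDimensional := by rw [← halg]; infer_instance }
  have hfr : Module.finrank ℚ (DzK d) = 2 := QuadraticAlgebra.finrank_eq_two _ _
  have hcl := h (DzK d) (by convert hfr) ⟨⟨0, 1⟩, by ext <;> simp [sq]⟩
  rw [NumberField.classNumber_eq_one_iff] at hcl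
  have hp0 : (p : DzK d) ≠ 0 := by exact_mod_cast hp.ne_zero
  obtain ⟨π, a, b, c, e, hπ, ha, hb, hc, he, h1, h2, h3⟩ : ∃ π a b c e : DzK d,
      IsIntegral ℤ π ∧ IsIntegral ℤ a ∧ IsIntegral ℤ b ∧ IsIntegral ℤ c ∧ IsIntegral ℤ e ∧
      (p : DzK d) = π * a ∧ (⟨u, v⟩ : DzK d) = π * b ∧ π = p * c + ⟨u, v⟩ * e := by
    let θ : NumberField.RingOfIntegers (DzK d) := ⟨⟨u, v⟩, hi⟩
    obtain ⟨π, hπ⟩ := (hcl.principal (Ideal.span {(p : NumberField.RingOfIntegers (DzK d)), θ})).principal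
    have m1 : (p : NumberField.RingOfIntegers (DzK d)) ∈ Ideal.span {π} := by
      rw [← Ideal.submodule_span_eq, ← hπ]; exact Ideal.subset_span (by simp)
    have m2 : θ ∈ Ideal.span {π} := by
      rw [← Ideal.submodule_span_eq, ← hπ]; exact Ideal.subset_span (by simp)
    have m3 : π ∈ Ideal.span {(p : NumberField.RingOfIntegers (DzK d)), θ} := by
      rw [hπ]; exact Ideal.subset_span (by simp)
    obtain ⟨a, ha⟩ := Ideal.mem_span_singleton.1 m1
    obtain ⟨b, hb⟩ := Ideal.mem_span_singleton.1 m2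
    obtain ⟨c, e, hce⟩ := Ideal.mem_span_pair.1 m3
    refine ⟨π, a, b, c, e, π.2, a.2, b.2, c.2, e.2, ?_, ?_, ?_⟩
    · have := congrArg (fun z : NumberField.RingOfIntegers (DzK d) => (z : DzK d)) ha
      simpa using this
    · have := congrArg (fun z : NumberField.RingOfIntegers (DzK d) => (z : DzK d)) hb
      exact this
    · have := congrArg (fun z : NumberField.RingOfIntegers (DzK d) => (z : DzK d)) hce
      simp only [map_add, map_mul, map_natCast] at this
      rw [← this, mul_comm (p : DzK d), mul_comm _ (e : DzK d)]
      rfl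
  obtain ⟨⟨A, hA⟩, ⟨B, hB⟩, ⟨N, hN⟩⟩ := dz_coords hsq hπ
  obtain ⟨-, -, ⟨N', hN'⟩⟩ := dz_coords hsq ha
  have hdQ : (d : ℚ) < 0 := by exact_mod_cast hd
  have hN0 : 0 ≤ N := by
    have : (0 : ℚ) ≤ N := by rw [← hN]; nlinarith [sq_nonneg π.re, sq_nonneg π.im]
    exact_mod_cast this
  have hN0' : 0 ≤ N' := by
    have : (0 : ℚ) ≤ N' := by rw [← hN']; nlinarith [sq_nonneg a.re, sq_nonneg a.im]
    exact_mod_cast this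
  have hst : ∀ x : DzK d, ∀ n : ℤ, x.re ^ 2 - d * x.im ^ 2 = n → x * star x = (n : DzK d) := by
    intro x n hx
    ext <;> simp
    · rw [← hx]; ring
    · ring
  have hprod : N * N' = (p : ℤ) ^ 2 := by
    have r1 := congrArg QuadraticAlgebra.re h1
    have r2 := congrArg QuadraticAlgebra.im h1
    simp at r1 r2
    have : (N : ℚ) * N' = p ^ 2 := by
      rw [← hN, ← hN', r1]
      linear_combination (d : ℚ) * (π.re * a.im + π.im * a.re) * r2
    exact_mod_cast this
  obtain ⟨n, rfl⟩ := Int.eq_ofNat_of_zero_le hN0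
  obtain ⟨n', rfl⟩ := Int.eq_ofNat_of_zero_le hN0'
  have hprod' : n * n' = p ^ 2 := by exact_mod_cast hprod
  obtain ⟨j, hj, hnj⟩ := (Nat.dvd_prime_pow hp).1 ⟨n', hprod'.symm⟩
  have hpθ : ∀ w : DzK d, IsIntegral ℤ w → (⟨u, v⟩ : DzK d) = p * w → False := by
    intro w hw hwe
    apply hn
    have hpq : (p : ℚ) ≠ 0 := by exact_mod_cast hp.ne_zero
    have r1 : u = p * w.re := by simpa using congrArg QuadraticAlgebra.re hwe
    have r2 : v = p * w.im := by simpa using congrArg QuadraticAlgebra.im hwe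
    have e1 : u / p = w.re := by rw [r1]; field_simp
    have e2 : v / p = w.im := by rw [r2]; field_simp
    rw [e1, e2]
    exact hw
  interval_cases j
  · exfalso
    have hθs : (⟨u, v⟩ : DzK d) * star ⟨u, v⟩ = ((p * m : ℤ) : DzK d) :=
      hst _ _ (by push_cast; exact hm)
    have hπs := hst π n hN
    rw [hnj] at hπs
    simp at hπs
    have hs : star (⟨u, v⟩ : DzK d) = p * ((star ⟨u, v⟩ * c + m * e) * star π) := by
      calc star (⟨u, v⟩ : DzK d) = star ⟨u, v⟩ * (π * star π) := by rw [hπs, mul_one]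
        _ = star ⟨u, v⟩ * ((p * c + ⟨u, v⟩ * e) * star π) := by rw [← h3]
        _ = (p * star ⟨u, v⟩ * c + ⟨u, v⟩ * star ⟨u, v⟩ * e) * star π := by ring
        _ = _ := by rw [hθs]; push_cast; ring
    have hs2 := congrArg star hs
    rw [star_star, star_mul', star_natCast] at hs2
    refine hpθ _ (dz_star_int ?_) hs2
    exact (((dz_star_int hi).mul hc).add ((isIntegral_algebraMap (R := ℤ) (x := m)).mul he)).mul
      (dz_star_int hπ)
  · refine ⟨A, B, ?_⟩
    have : (A : ℚ) ^ 2 - d * B ^ 2 = 4 * p := by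
      rw [← hA, ← hB]
      simp at hnj hN
      rw [← hnj, ← hN]; ring
    exact_mod_cast this
  · exfalso
    have hn1 : n' = 1 := by
      rw [hnj] at hprod'
      exact Nat.eq_of_mul_eq_mul_left (pow_pos hp.pos 2) (by rw [hprod', mul_one])
    have has := hst a n' hN'
    rw [hn1] at has
    simp at has
    refine hpθ (star a * b) ((dz_star_int ha).mul hb) ?_
    rw [h1, h2]
    calc π * b = π * b * (a * star a) := by rw [has, mul_one]
      _ = _ := by ring

theorem dz_integral_of (u v : ℚ) (A N : ℤ) (hA : 2 * u = A) (hN : u ^ 2 - d * v ^ 2 = N) :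
    IsIntegral ℤ (⟨u, v⟩ : DzK d) := by
  refine ⟨Polynomial.X ^ 2 - Polynomial.C A * Polynomial.X + Polynomial.C N, ?_, ?_⟩
  · monicity!
  · simp only [Polynomial.eval₂_add, Polynomial.eval₂_sub, Polynomial.eval₂_pow, Polynomial.eval₂_X,
      Polynomial.eval₂_mul, Polynomial.eval₂_C]
    simp only [eq_intCast]
    ext
    · simp [sq]
      linear_combination (-1 : ℚ) * hN + u * hA
    · simp [sq]
      linear_combination v * hA

theorem dz_class (hd : d < -8) (hsq : Squarefree d)
    (h : ∀ (K : Type) [Field K] [NumberField K], Module.finrank ℚ K = 2 →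
          (∃ α : K, α ^ 2 = (d : K)) → NumberField.classNumber K = 1) :
    d % 4 = 1 ∧ ∀ p : ℕ, p.Prime →
      ((p ≠ 2 ∧ ∃ r : ℤ, (p : ℤ) ∣ r ^ 2 - d) ∨ (p = 2 ∧ d % 8 = 1)) →
      ∃ A B : ℤ, A ^ 2 - d * B ^ 2 = 4 * p := by
  have hd0 : d < 0 := by omega
  constructor
  · by_contra hne
    have h4 : d % 4 ≠ 0 := by
      intro h0
      have := hsq 2 (by omega)
      rw [Int.isUnit_iff] at this
      omega
    have hAB : ∃ A B : ℤ, A ^ 2 - d * B ^ 2 = 4 * (2 : ℕ) := by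
      rcases (by omega : d % 4 = 2 ∨ d % 4 = 3) with h2 | h3
      · refine dz_key hd0 hsq h 2 Nat.prime_two 0 1 (dz_integral_of _ _ 0 (-d) (by simp) (by simp))
          (-d / 2) ?_ ?_
        · have : -d = 2 * (-d / 2) := by omega
          have : -(d : ℚ) = 2 * ((-d / 2 : ℤ) : ℚ) := by exact_mod_cast this
          push_cast
          linarith
        · intro hi
          obtain ⟨-, -, N, hN⟩ := dz_coords hsq hi
          simp at hN
          have : -(d : ℚ) = 4 * N := by rw [← hN]; ring
          have : -d = 4 * N := by exact_mod_cast this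
          omega
      · refine dz_key hd0 hsq h 2 Nat.prime_two 1 1 (dz_integral_of _ _ 2 (1 - d) (by simp) (by simp))
          ((1 - d) / 2) ?_ ?_
        · have : 1 - d = 2 * ((1 - d) / 2) := by omega
          have : 1 - (d : ℚ) = 2 * (((1 - d) / 2 : ℤ) : ℚ) := by exact_mod_cast this
          push_cast
          linarith
        · intro hi
          obtain ⟨-, -, N, hN⟩ := dz_coords hsq hi
          simp at hN
          have : 1 - (d : ℚ) = 4 * N := by rw [← hN]; ring
          have : 1 - d = 4 * N := by exact_mod_cast this
          omega
    obtain ⟨A, B, hAB⟩ := hAB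
    push_cast at hAB
    have hB : B = 0 := by
      by_contra hB
      have : 1 ≤ B ^ 2 := by have := sq_pos_of_ne_zero hB; omega
      nlinarith [sq_nonneg A]
    subst hB
    have h1 : A < 3 := by nlinarith
    have h2 : -3 < A := by nlinarith
    interval_cases A <;> omega
  · rintro p hp (⟨hp2, r, m, hr⟩ | ⟨rfl, h8⟩)
    · refine dz_key hd0 hsq h p hp r 1
        (dz_integral_of _ _ (2 * r) (r ^ 2 - d) (by push_cast; ring) (by push_cast; ring)) m ?_ ?_
      · have : (r : ℚ) ^ 2 - d = p * m := by exact_mod_cast hr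
        linarith
      · intro hi
        obtain ⟨-, ⟨B, hB⟩, -⟩ := dz_coords hsq hi
        simp at hB
        have hpq : (p : ℚ) ≠ 0 := by exact_mod_cast hp.ne_zero
        field_simp at hB
        have h2 : (2 : ℤ) = p * B := by exact_mod_cast hB
        have h3 : (p : ℤ) ∣ (2 : ℕ) := ⟨B, by exact_mod_cast h2⟩
        have h4 : p ∣ 2 := by exact_mod_cast h3
        exact hp2 ((Nat.prime_dvd_prime_iff_eq hp Nat.prime_two).1 h4)
    · refine dz_key hd0 hsq h 2 hp (1 / 2) (1 / 2)
        (dz_integral_of _ _ 1 ((1 - d) / 4) (by norm_num) ?_) ((1 - d) / 8) ?_ ?_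
      · have : 1 - d = 4 * ((1 - d) / 4) := by omega
        have : 1 - (d : ℚ) = 4 * (((1 - d) / 4 : ℤ) : ℚ) := by exact_mod_cast this
        linarith
      · have : 1 - d = 8 * ((1 - d) / 8) := by omega
        have : 1 - (d : ℚ) = 8 * (((1 - d) / 8 : ℤ) : ℚ) := by exact_mod_cast this
        push_cast
        linarith
      · intro hi
        obtain ⟨-, ⟨B, hB⟩, -⟩ := dz_coords hsq hi
        have : (1 : ℚ) = 2 * B := by rw [← hB]; norm_num
        have : (1 : ℤ) = 2 * B := by exact_mod_cast this
        omega
end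

section

def dzq (k : ℤ) (z : ℤ × ℤ) : ℤ := z.1 ^ 2 + z.1 * z.2 + k * z.2 ^ 2

def dzrep (k : ℤ) (n : ℕ) : Set (ℤ × ℤ) := {z | dzq k z = n}

def dzmul (k u v : ℤ) (z : ℤ × ℤ) : ℤ × ℤ := (z.1 * u - k * z.2 * v, z.1 * v + z.2 * u + z.2 * v)

variable {k : ℤ}

theorem dzrep_finite (hk : 1 ≤ k) (n : ℕ) : (dzrep k n).Finite := by
  apply ((Set.finite_Icc (-(2 * n : ℤ)) (2 * n)).prod (Set.finite_Icc (-(2 * n : ℤ)) (2 * n))).subset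
  rintro ⟨x, y⟩ h
  have h : x ^ 2 + x * y + k * y ^ 2 = n := h
  have h1 : x ^ 2 + y ^ 2 ≤ 2 * n := by nlinarith [sq_nonneg (x + y), sq_nonneg y]
  have hx : x ^ 2 ≤ 2 * n := by nlinarith [sq_nonneg y]
  have hy : y ^ 2 ≤ 2 * n := by nlinarith [sq_nonneg x]
  have key : ∀ w : ℤ, w ^ 2 ≤ 2 * n → -(2 * n : ℤ) ≤ w ∧ w ≤ 2 * n := by
    intro w hw
    have h1 := Int.le_self_sq w
    have h2 := Int.le_self_sq (-w)
    have h3 : (-w) ^ 2 = w ^ 2 := by ring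
    constructor <;> linarith
  exact ⟨key x hx, key y hy⟩

theorem dzmul_q (u v : ℤ) (z : ℤ × ℤ) : dzq k (dzmul k u v z) = dzq k (u, v) * dzq k z := by
  simp only [dzq, dzmul]; ring

theorem dzmul_inj {u v : ℤ} (h : dzq k (u, v) ≠ 0) : Function.Injective (dzmul k u v) := by
  rintro ⟨x, y⟩ ⟨x', y'⟩ hz
  simp only [dzmul, Prod.mk.injEq] at hz
  obtain ⟨h1, h2⟩ := hz
  simp only [dzq] at h
  ext
  · apply mul_left_cancel₀ h
    show _ * x = _ * x'
    linear_combination (u + v) * h1 + k * v * h2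
  · apply mul_left_cancel₀ h
    show _ * y = _ * y'
    linear_combination u * h2 - v * h1

theorem dz_char {p : ℕ} (hp : p.Prime) {u v : ℤ} (huv : dzq k (u, v) = p) (n : ℕ) (z : ℤ × ℤ) :
    (dzq k z = (p * n : ℕ) ∧ (p : ℤ) ∣ z.2 * u - z.1 * v) ↔ z ∈ dzmul k u v '' dzrep k n := by
  have hp' : Prime (p : ℤ) := Nat.prime_iff_prime_int.1 hp
  obtain ⟨x, y⟩ := z
  constructor
  · rintro ⟨hq, t, ht⟩
    simp only at ht
    simp only [dzq] at hq huv
    push_cast at hq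
    have hs : (p : ℤ) ∣ x * (u + v) + k * y * v := by
      apply hp'.dvd_of_dvd_pow (n := 2)
      refine ⟨p * n - t * (x * (u + v) + k * y * v) - k * p * t ^ 2, ?_⟩
      have e : (x * (u + v) + k * y * v) ^ 2 + (x * (u + v) + k * y * v) * (y * u - x * v)
        + k * (y * u - x * v) ^ 2 = p * (p * n) := by
        rw [← hq]; nth_rewrite 1 [← huv]; ring
      rw [ht] at e
      linear_combination e
    obtain ⟨s, hs⟩ := hs
    refine ⟨(s, t), ?_, ?_⟩
    · simp only [dzrep, dzq, Set.mem_ofPred_eq]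
      have : (p : ℤ) ^ 2 ≠ 0 := pow_ne_zero _ hp'.ne_zero
      apply mul_left_cancel₀ this
      have e : (x * (u + v) + k * y * v) ^ 2 + (x * (u + v) + k * y * v) * (y * u - x * v)
        + k * (y * u - x * v) ^ 2 = p * (p * n) := by
        rw [← hq]; nth_rewrite 1 [← huv]; ring
      rw [ht, hs] at e
      linear_combination e
    · simp only [dzmul]
      ext
      · apply mul_left_cancel₀ hp'.ne_zero
        show (p : ℤ) * (s * u - k * t * v) = p * x
        linear_combination (-u) * hs + k * v * ht + x * huv
      · apply mul_left_cancel₀ hp'.ne_zero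
        show (p : ℤ) * (s * v + t * u + t * v) = p * y
        linear_combination (-v) * hs - (u + v) * ht + y * huv
  · rintro ⟨⟨a, b⟩, hab, h⟩
    rw [← h]
    refine ⟨?_, ?_⟩
    · rw [dzmul_q, huv]
      have : dzq k (a, b) = n := hab
      rw [this]; push_cast; rfl
    · refine ⟨b, ?_⟩
      simp only [dzmul]
      simp only [dzq] at huv
      rw [← huv]; ring

theorem dz_pcount {p : ℕ} (hp : p.Prime) (n : ℕ) :
    ({z : ℤ × ℤ | dzq k z = (p * n : ℕ) ∧ (p : ℤ) ∣ z.1 ∧ (p : ℤ) ∣ z.2}).ncard =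
      if p ∣ n then (dzrep k (n / p)).ncard else 0 := by
  have hp0 : (p : ℤ) ≠ 0 := by exact_mod_cast hp.ne_zero
  split_ifs with h
  · obtain ⟨m, rfl⟩ := h
    rw [Nat.mul_div_cancel_left _ hp.pos]
    have hinj : Function.Injective (fun z : ℤ × ℤ => ((p : ℤ) * z.1, (p : ℤ) * z.2)) := by
      rintro ⟨a, b⟩ ⟨c, e⟩ h
      simp only [Prod.mk.injEq] at h
      ext
      · exact mul_left_cancel₀ hp0 h.1
      · exact mul_left_cancel₀ hp0 h.2
    rw [← Set.ncard_image_of_injective (dzrep k m) hinj]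
    congr 1
    ext ⟨x, y⟩
    simp only [Set.mem_ofPred_eq, Set.mem_image, Prod.exists, Prod.mk.injEq, dzrep, dzq]
    constructor
    · rintro ⟨h, ⟨a, rfl⟩, ⟨b, rfl⟩⟩
      refine ⟨a, b, ?_, rfl, rfl⟩
      apply mul_left_cancel₀ (pow_ne_zero 2 hp0)
      push_cast at h
      linear_combination h
    · rintro ⟨a, b, h, rfl, rfl⟩
      refine ⟨?_, dvd_mul_right _ _, dvd_mul_right _ _⟩
      push_cast
      rw [← h]; ring
  · convert Set.ncard_empty (ℤ × ℤ)
    ext ⟨x, y⟩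
    simp only [Set.mem_ofPred_eq, Set.mem_empty_iff_false, iff_false, dzq]
    rintro ⟨e, ⟨a, rfl⟩, ⟨b, rfl⟩⟩
    apply h
    have : (p : ℤ) ∣ n := by
      refine ⟨a ^ 2 + a * b + k * b ^ 2, ?_⟩
      apply mul_left_cancel₀ hp0
      push_cast at e
      linear_combination -e
    exact_mod_cast this

theorem dz_inert {p : ℕ} (hp : p.Prime)
    (hin : ∀ z, (p : ℤ) ∣ dzq k z → (p : ℤ) ∣ z.1 ∧ (p : ℤ) ∣ z.2) (n : ℕ) :
    (dzrep k (p * n)).ncard = if p ∣ n then (dzrep k (n / p)).ncard else 0 := by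
  rw [← dz_pcount hp]
  congr 1
  ext z
  simp only [dzrep, Set.mem_ofPred_eq]
  refine ⟨fun h => ⟨h, hin z ⟨n, by rw [h]; push_cast; rfl⟩⟩, fun h => h.1⟩

theorem dz_split_union {p : ℕ} (hp : p.Prime) {u v : ℤ} (huv : dzq k (u, v) = p) (n : ℕ) :
    dzrep k (p * n) = dzmul k u v '' dzrep k n ∪ dzmul k (u + v) (-v) '' dzrep k n := by
  have hp' : Prime (p : ℤ) := Nat.prime_iff_prime_int.1 hp
  have huv' : dzq k (u + v, -v) = p := by rw [← huv]; simp only [dzq]; ring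
  ext z
  rw [Set.mem_union, ← dz_char hp huv, ← dz_char hp huv', ← and_or_left]
  simp only [dzrep, Set.mem_ofPred_eq]
  refine ⟨fun h => ⟨h, ?_⟩, fun h => h.1⟩
  apply hp'.dvd_or_dvd
  refine ⟨z.2 ^ 2 - n * v ^ 2, ?_⟩
  simp only [dzq] at h huv
  push_cast at h
  linear_combination z.2 ^ 2 * huv - v ^ 2 * h

theorem dz_not_dvd {p : ℕ} (hp : p.Prime) {u v : ℤ} (huv : dzq k (u, v) = p) : ¬ (p : ℤ) ∣ v := by
  have hp' : Prime (p : ℤ) := Nat.prime_iff_prime_int.1 hp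
  rintro ⟨t, rfl⟩
  simp only [dzq] at huv
  have : (p : ℤ) ∣ u := by
    apply hp'.dvd_of_dvd_pow (n := 2)
    exact ⟨1 - u * t - k * p * t ^ 2, by linear_combination huv⟩
  obtain ⟨s, rfl⟩ := this
  have h1 : (p : ℤ) * (s ^ 2 + s * t + k * t ^ 2) = 1 := by
    apply mul_left_cancel₀ hp'.ne_zero
    linear_combination huv
  exact hp'.not_isUnit (IsUnit.of_mul_eq_one _ h1)

theorem dz_split (hk : 1 ≤ k) {p : ℕ} (hp : p.Prime) {u v : ℤ} (huv : dzq k (u, v) = p)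
    (hD : ¬ (p : ℤ) ∣ 4 * k - 1) (n : ℕ) :
    ((dzrep k (p * n)).ncard : ℤ) = 2 * (dzrep k n).ncard -
      if p ∣ n then ((dzrep k (n / p)).ncard : ℤ) else 0 := by
  have hp' : Prime (p : ℤ) := Nat.prime_iff_prime_int.1 hp
  have huv' : dzq k (u + v, -v) = p := by rw [← huv]; simp only [dzq]; ring
  have hv := dz_not_dvd hp huv
  have hinter : dzmul k u v '' dzrep k n ∩ dzmul k (u + v) (-v) '' dzrep k n =
      {z : ℤ × ℤ | dzq k z = (p * n : ℕ) ∧ (p : ℤ) ∣ z.1 ∧ (p : ℤ) ∣ z.2} := by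
    ext z
    rw [Set.mem_inter_iff, ← dz_char hp huv, ← dz_char hp huv', ← and_and_left]
    obtain ⟨x, y⟩ := z
    simp only [Set.mem_ofPred_eq]
    refine and_congr_right fun hq => ⟨?_, ?_⟩
    · rintro ⟨h1, h2⟩
      have e1 : (p : ℤ) ∣ 2 * x + y := by
        have : (p : ℤ) ∣ v * (2 * x + y) := by
          exact (dvd_sub h2 h1).trans (dvd_of_eq (by ring))
        exact (hp'.dvd_or_dvd this).resolve_left hv
      have e2 : (p : ℤ) ∣ y * (2 * u + v) := by
        exact (dvd_add h2 h1).trans (dvd_of_eq (by ring))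
      have e3 : (p : ℤ) ∣ y := by
        refine (hp'.dvd_or_dvd e2).resolve_right fun ⟨t, ht⟩ => ?_
        have : (p : ℤ) ∣ (4 * k - 1) * v ^ 2 := by
          refine ⟨4 - p * t ^ 2, ?_⟩
          simp only [dzq] at huv
          linear_combination 4 * huv - (2 * u + v + p * t) * ht
        rcases hp'.dvd_or_dvd this with h | h
        · exact hD h
        · exact hv (hp'.dvd_of_dvd_pow h)
      refine ⟨?_, e3⟩
      have : (p : ℤ) ∣ x * v := by
        exact (dvd_sub (e3.mul_right u) h1).trans (dvd_of_eq (by ring))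
      exact (hp'.dvd_or_dvd this).resolve_right hv
    · rintro ⟨h1, h2⟩
      exact ⟨dvd_sub (h2.mul_right _) (h1.mul_right _), dvd_sub (h2.mul_right _) (h1.mul_right _)⟩
  have hf := dzrep_finite hk n
  have hpq : (p : ℤ) ≠ 0 := hp'.ne_zero
  have hcard := Set.ncard_union_add_ncard_inter (dzmul k u v '' dzrep k n)
    (dzmul k (u + v) (-v) '' dzrep k n) (hf.image _) (hf.image _)
  rw [← dz_split_union hp huv, hinter, dz_pcount hp,
    Set.ncard_image_of_injective _ (dzmul_inj (by rw [huv]; exact hpq)),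
    Set.ncard_image_of_injective _ (dzmul_inj (by rw [huv']; exact hpq))] at hcard
  split_ifs at hcard ⊢ <;> omega

theorem dz_ram {p : ℕ} (hp : p.Prime) {u v : ℤ} (huv : dzq k (u, v) = p)
    (hD : (p : ℤ) ∣ 4 * k - 1) (n : ℕ) :
    (dzrep k (p * n)).ncard = (dzrep k n).ncard := by
  have hp' : Prime (p : ℤ) := Nat.prime_iff_prime_int.1 hp
  have huv' : dzq k (u + v, -v) = p := by rw [← huv]; simp only [dzq]; ring
  have : dzmul k u v '' dzrep k n = dzmul k (u + v) (-v) '' dzrep k n := by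
    ext z
    rw [← dz_char hp huv, ← dz_char hp huv']
    obtain ⟨x, y⟩ := z
    refine and_congr_right fun hq => ?_
    have e1 : (p : ℤ) ∣ 2 * x + y := by
      apply hp'.dvd_of_dvd_pow (n := 2)
      obtain ⟨c, hc⟩ := hD
      refine ⟨4 * n - c * y ^ 2, ?_⟩
      simp only [dzq] at hq
      push_cast at hq
      linear_combination 4 * hq - y ^ 2 * hc
    simp only
    constructor
    · intro h
      exact (dvd_add h (e1.mul_left v)).trans (dvd_of_eq (by ring))
    · intro h
      exact (dvd_sub h (e1.mul_left v)).trans (dvd_of_eq (by ring))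
  rw [dz_split_union hp huv, ← this, Set.union_self]
  exact Set.ncard_image_of_injective _ (dzmul_inj (by rw [huv]; exact hp'.ne_zero))
end

section
open scoped NumberTheorySymbols

theorem dz_jac {D p : ℕ} (hD : D % 4 = 3) (hp : p % 2 = 1) : J((p : ℤ) | D) = J(-(D : ℤ) | p) := by
  rw [jacobiSym.neg _ (Nat.odd_iff.2 hp)]
  rcases (by omega : p % 4 = 1 ∨ p % 4 = 3) with h | h
  · rw [ZMod.χ₄_nat_one_mod_four h, one_mul]
    exact jacobiSym.quadratic_reciprocity_one_mod_four h (Nat.odd_iff.2 (by omega))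
  · rw [ZMod.χ₄_nat_three_mod_four h, jacobiSym.quadratic_reciprocity_three_mod_four h hD]
    ring

theorem dz_sum_rec (g : ℕ → ℤ) (hg : ∀ a b, g (a * b) = g a * g b) {p n : ℕ} (hp : p.Prime)
    (hn : n ≠ 0) :
    ∑ e ∈ (p * n).divisors, g e = (1 + g p) * ∑ e ∈ n.divisors, g e -
      g p * (if p ∣ n then ∑ e ∈ (n / p).divisors, g e else 0) := by
  classical
  have hinj : ∀ s : Finset ℕ, ∑ e ∈ s.image (p * ·), g e = g p * ∑ e ∈ s, g e := by
    intro s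
    rw [Finset.sum_image (fun a _ b _ h => Nat.eq_of_mul_eq_mul_left hp.pos h), Finset.mul_sum]
    exact Finset.sum_congr rfl fun e _ => hg _ _
  have hU : (p * n).divisors = n.divisors ∪ n.divisors.image (p * ·) := by
    ext e
    simp only [Nat.mem_divisors, Finset.mem_union, Finset.mem_image]
    constructor
    · rintro ⟨h, h0⟩
      by_cases hpe : p ∣ e
      · obtain ⟨c, rfl⟩ := hpe
        exact Or.inr ⟨c, ⟨Nat.dvd_of_mul_dvd_mul_left hp.pos h, hn⟩, rfl⟩
      · exact Or.inl ⟨(Nat.Coprime.symm ((Nat.Prime.coprime_iff_not_dvd hp).2 hpe)).dvd_of_dvd_mul_left h, hn⟩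
    · rintro (⟨h, -⟩ | ⟨c, ⟨h, -⟩, rfl⟩)
      · exact ⟨h.mul_left p, mul_ne_zero hp.ne_zero hn⟩
      · exact ⟨Nat.mul_dvd_mul_left p h, mul_ne_zero hp.ne_zero hn⟩
  have hI : ∑ e ∈ n.divisors ∩ n.divisors.image (p * ·), g e =
      g p * (if p ∣ n then ∑ e ∈ (n / p).divisors, g e else 0) := by
    split_ifs with h
    · obtain ⟨m, rfl⟩ := h
      rw [Nat.mul_div_cancel_left _ hp.pos, ← hinj]
      congr 1
      ext e
      simp only [Nat.mem_divisors, Finset.mem_inter, Finset.mem_image]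
      have hm : m ≠ 0 := right_ne_zero_of_mul hn
      constructor
      · rintro ⟨⟨h1, -⟩, c, ⟨h2, -⟩, rfl⟩
        exact ⟨c, ⟨Nat.dvd_of_mul_dvd_mul_left hp.pos h1, hm⟩, rfl⟩
      · rintro ⟨c, ⟨h, -⟩, rfl⟩
        exact ⟨⟨Nat.mul_dvd_mul_left p h, hn⟩, c, ⟨h.mul_left p, hn⟩, rfl⟩
    · rw [mul_zero]
      apply Finset.sum_eq_zero
      intro e he
      simp only [Nat.mem_divisors, Finset.mem_inter, Finset.mem_image] at he
      obtain ⟨⟨h1, -⟩, c, ⟨h2, -⟩, rfl⟩ := he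
      exact absurd (dvd_of_mul_right_dvd h1) h
  have := Finset.sum_union_inter (s₁ := n.divisors) (s₂ := n.divisors.image (p * ·)) (f := g)
  rw [← hU, hI, hinj] at this
  linear_combination this

theorem dz_rep_count {D : ℕ} {k : ℤ} (hDk : (D : ℤ) = 4 * k - 1) (hk : 2 ≤ k)
    (H : ∀ p : ℕ, p.Prime →
      ((p ≠ 2 ∧ ∃ r : ℤ, (p : ℤ) ∣ r ^ 2 - (-D)) ∨ (p = 2 ∧ (-D : ℤ) % 8 = 1)) →
      ∃ A B : ℤ, A ^ 2 - (-D) * B ^ 2 = 4 * p) (n : ℕ) (hn : n ≠ 0) :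
    ((dzrep k n).ncard : ℤ) = 2 * ∑ e ∈ n.divisors, J((e : ℤ) | D) := by
  have hD3 : D % 4 = 3 := by omega
  have hDne : NeZero D := ⟨by omega⟩
  have H' : ∀ p : ℕ, p.Prime →
      ((p ≠ 2 ∧ ∃ r : ℤ, (p : ℤ) ∣ r ^ 2 - (-D)) ∨ (p = 2 ∧ (-D : ℤ) % 8 = 1)) →
      ∃ u v, dzq k (u, v) = p := by
    intro p hp h
    obtain ⟨A, B, hAB⟩ := H p hp h
    rw [hDk] at hAB
    have hpar : (A - B) % 2 = 0 := by
      have h1 : (A ^ 2 - B ^ 2) % 4 = 0 := by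
        have : A ^ 2 - B ^ 2 = 4 * (p - k * B ^ 2) := by linear_combination hAB
        omega
      rcases Int.emod_two_eq_zero_or_one A with ha | ha <;>
        rcases Int.emod_two_eq_zero_or_one B with hb | hb
      · omega
      · obtain ⟨a, rfl⟩ : ∃ a, A = 2 * a := ⟨A / 2, by omega⟩
        obtain ⟨b, rfl⟩ : ∃ b, B = 2 * b + 1 := ⟨B / 2, by omega⟩
        ring_nf at h1
        omega
      · obtain ⟨a, rfl⟩ : ∃ a, A = 2 * a + 1 := ⟨A / 2, by omega⟩
        obtain ⟨b, rfl⟩ : ∃ b, B = 2 * b := ⟨B / 2, by omega⟩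
        ring_nf at h1
        omega
      · omega
    obtain ⟨c, hc⟩ : ∃ c, A - B = 2 * c := ⟨(A - B) / 2, by omega⟩
    obtain rfl : A = B + 2 * c := by omega
    refine ⟨c, B, ?_⟩
    simp only [dzq]
    linarith
  have hrec : ∀ p : ℕ, p.Prime → ∀ n : ℕ, ((dzrep k (p * n)).ncard : ℤ) =
      (1 + J((p : ℤ) | D)) * (dzrep k n).ncard - J((p : ℤ) | D) *
      (if p ∣ n then ((dzrep k (n / p)).ncard : ℤ) else 0) := by
    intro p hp n
    have hfp : Fact p.Prime := ⟨hp⟩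
    have hodd : p ≠ 2 → p % 2 = 1 := fun h => hp.eq_two_or_odd.resolve_left h
    have hpd : J((p : ℤ) | D) ≠ 0 → ¬ (p : ℤ) ∣ 4 * k - 1 := by
      intro h h1
      rw [← hDk] at h1
      apply h
      rw [jacobiSym.eq_zero_iff_not_coprime]
      intro h2
      have h2 : Nat.Coprime p D := by simpa [Int.gcd, Nat.Coprime] using h2
      exact (Nat.Prime.coprime_iff_not_dvd hp).1 h2 (by exact_mod_cast h1)
    rcases jacobiSym.trichotomy (p : ℤ) D with h | h | h
    · have hpD : (p : ℤ) ∣ D := by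
        rw [jacobiSym.eq_zero_iff_not_coprime] at h
        have h : ¬ Nat.Coprime p D := by simpa [Int.gcd, Nat.Coprime] using h
        have := not_not.1 (mt (Nat.Prime.coprime_iff_not_dvd hp).2 h)
        exact_mod_cast this
      have hp2 : p ≠ 2 := by
        rintro rfl
        omega
      obtain ⟨u, v, huv⟩ := H' p hp (Or.inl ⟨hp2, 0, by simpa using hpD⟩)
      rw [h, dz_ram hp huv (by rwa [← hDk])]
      ring
    · obtain ⟨u, v, huv⟩ : ∃ u v, dzq k (u, v) = p := by
        apply H' p hp
        by_cases hp2 : p = 2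
        · right
          refine ⟨hp2, ?_⟩
          subst hp2
          rw [show ((2 : ℕ) : ℤ) = 2 from rfl, jacobiSym.at_two (Nat.odd_iff.2 (by omega)),
            ZMod.χ₈_nat_eq_if_mod_eight] at h
          split_ifs at h <;> omega
        · left
          refine ⟨hp2, ?_⟩
          have h1 := h
          rw [dz_jac hD3 (hodd hp2)] at h1
          obtain ⟨r, hr⟩ := ZMod.isSquare_of_jacobiSym_eq_one h1
          refine ⟨(r.val : ℤ), ?_⟩
          rw [← ZMod.intCast_zmod_eq_zero_iff_dvd]
          push_cast
          rw [ZMod.natCast_zmod_val]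
          push_cast at hr
          rw [sq, ← hr]
          ring
      rw [h, dz_split (by omega) hp huv (hpd (by rw [h]; norm_num))]
      ring
    · have := dz_inert (k := k) hp ?_ n
      · rw [h, this]
        split_ifs <;> simp
      · rintro ⟨x, y⟩ hq
        simp only [dzq] at hq
        by_cases hp2 : p = 2
        · subst hp2
          rw [show ((2 : ℕ) : ℤ) = 2 from rfl, jacobiSym.at_two (Nat.odd_iff.2 (by omega)),
            ZMod.χ₈_nat_eq_if_mod_eight] at h
          have hk1 : k % 2 = 1 := by split_ifs at h <;> omega
          have hq : (x ^ 2 + x * y + k * y ^ 2) % 2 = 0 := by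
            simpa using Int.emod_eq_zero_of_dvd hq
          obtain ⟨j, rfl⟩ : ∃ j, k = 2 * j + 1 := ⟨k / 2, by omega⟩
          rcases Int.emod_two_eq_zero_or_one x with ha | ha <;>
            rcases Int.emod_two_eq_zero_or_one y with hb | hb
          · push_cast
            constructor <;> omega
          · exfalso
            simp [Int.add_emod, Int.mul_emod, pow_two, ha, hb] at hq
          · exfalso
            simp [Int.add_emod, Int.mul_emod, pow_two, ha, hb] at hq
          · exfalso
            simp [Int.add_emod, Int.mul_emod, pow_two, ha, hb] at hq
        · rw [dz_jac hD3 (hodd hp2)] at h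
          obtain ⟨c, hc⟩ := hq
          have h1 : (p : ℤ) ∣ (2 * x + y) ^ 2 - (-(D : ℤ)) * y ^ 2 :=
            ⟨4 * c, by rw [hDk]; linear_combination 4 * hc⟩
          obtain ⟨h2, h3⟩ := jacobiSym.prime_dvd_of_eq_neg_one h h1
          refine ⟨?_, h3⟩
          have h4 : (p : ℤ) ∣ 2 * x := by simpa using dvd_sub h2 h3
          have hp' : Prime (p : ℤ) := Nat.prime_iff_prime_int.1 hp
          refine (hp'.dvd_or_dvd h4).resolve_left fun h5 => ?_
          have : p ∣ 2 := by exact_mod_cast h5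
          exact hp2 ((Nat.prime_dvd_prime_iff_eq hp Nat.prime_two).1 this)
  induction n using Nat.strong_induction_on with
  | _ n ih =>
    by_cases h1 : n = 1
    · subst h1
      have : dzrep k 1 = {(1, 0), (-1, 0)} := by
        ext ⟨x, y⟩
        simp only [dzrep, dzq, Set.mem_ofPred_eq, Set.mem_insert_iff, Set.mem_singleton_iff,
          Prod.mk.injEq]
        constructor
        · intro h
          have hy : y = 0 := by
            by_contra hy
            have : 1 ≤ y ^ 2 := by have := sq_pos_of_ne_zero hy; omega
            push_cast at h
            nlinarith [sq_nonneg (2 * x + y)]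
          subst hy
          have hx : x ^ 2 = 1 := by push_cast at h; linarith
          rcases mul_self_eq_one_iff.1 ((sq x).symm.trans hx) with h | h <;> simp [h]
        · rintro (⟨rfl, rfl⟩ | ⟨rfl, rfl⟩) <;> simp
      rw [this, Set.ncard_pair (by simp)]
      simp
    · have hp := Nat.minFac_prime h1
      obtain ⟨m, hm⟩ := Nat.minFac_dvd n
      set p := n.minFac
      have hm0 : m ≠ 0 := by rintro rfl; simp at hm; exact hn hm
      have hmn : m < n := by
        rw [hm]
        exact lt_mul_of_one_lt_left (Nat.pos_of_ne_zero hm0) hp.one_lt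
      clear_value p
      subst hm
      rw [hrec p hp, dz_sum_rec (fun e => J((e : ℤ) | D))
        (fun a b => by push_cast; exact jacobiSym.mul_left _ _ _) hp hm0, ih m hmn hm0]
      split_ifs with hd
      · rw [ih (m / p) ((Nat.div_le_self _ _).trans_lt hmn)
          (Nat.div_pos (Nat.le_of_dvd (Nat.pos_of_ne_zero hm0) hd) hp.pos).ne']
        ring
      · ring
end

section
open scoped NumberTheorySymbols

noncomputable def dzchi (D : ℕ) [NeZero D] : DirichletCharacter ℂ D where
  toFun a := ((J((a.val : ℤ) | D) : ℤ) : ℂ)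
  map_one' := by
    have : J((((1 : ZMod D).val : ℕ) : ℤ) | D) = J(((1 : ℕ) : ℤ) | D) := by
      apply jacobiSym.mod_left'
      have h := ZMod.val_natCast D 1
      rw [Nat.cast_one] at h
      rw [h]
      simp
    rw [this]
    simp
  map_mul' a b := by
    rw [ZMod.val_mul]
    push_cast
    rw [← jacobiSym.mod_left, jacobiSym.mul_left]
    push_cast
    rfl
  map_nonunit' a ha := by
    rw [← ZMod.natCast_zmod_val a, ZMod.isUnit_iff_coprime] at ha
    have : J((a.val : ℤ) | D) = 0 := by
      rw [jacobiSym.eq_zero_iff_not_coprime]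
      exact fun h => ha h
    exact_mod_cast this

theorem dzchi_apply (D : ℕ) [NeZero D] (n : ℕ) : dzchi D (n : ZMod D) = ((J((n : ℤ) | D) : ℤ) : ℂ) := by
  have : dzchi D (n : ZMod D) = ((J((((n : ZMod D).val : ℕ) : ℤ) | D) : ℤ) : ℂ) := rfl
  rw [this, ZMod.val_natCast]
  push_cast
  rw [← jacobiSym.mod_left]

theorem dzq_nonneg {k : ℤ} (hk : 1 ≤ k) (z : ℤ × ℤ) : 0 ≤ dzq k z := by
  simp only [dzq]
  nlinarith [sq_nonneg (2 * z.1 + z.2), sq_nonneg z.2]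

theorem dzq_cpow_summable {D : ℕ} [NeZero D] {k : ℤ} (hk : 2 ≤ k)
    (H : ∀ n : ℕ, n ≠ 0 → ((dzrep k n).ncard : ℤ) = 2 * ∑ e ∈ n.divisors, J((e : ℤ) | D))
    {s : ℂ} (hs : 1 < s.re) :
    Summable (fun z : ℤ × ℤ => ((dzq k z : ℤ) : ℂ) ^ (-s)) ∧
    ∑' z : ℤ × ℤ, ((dzq k z : ℤ) : ℂ) ^ (-s) =
      2 * (riemannZeta s * DirichletCharacter.LFunction (dzchi D) s) := by
  have hs0 : s ≠ 0 := by rintro rfl; simp at hs; linarith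
  set χ := dzchi D
  have hL : LSeriesHasSum (LSeries.convolution (1 : ℕ → ℂ) (fun n : ℕ => χ n)) s
      (riemannZeta s * DirichletCharacter.LFunction χ s) := by
    apply LSeriesHasSum.convolution
    · exact LSeriesHasSum_one hs
    · rw [DirichletCharacter.LFunction_eq_LSeries χ hs]
      exact (DirichletCharacter.LSeriesSummable_of_one_lt_re χ hs).LSeriesHasSum
  have hterm : ∀ n : ℕ, ((dzrep k n).ncard : ℂ) * (n : ℂ) ^ (-s) =
      2 * LSeries.term (LSeries.convolution (1 : ℕ → ℂ) (fun n : ℕ => χ n)) s n := by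
    intro n
    by_cases hn : n = 0
    · subst hn
      simp [hs0]
    · rw [LSeries.term_of_ne_zero hn, cpow_neg, ← div_eq_mul_inv, ← mul_div_assoc]
      congr 1
      have h := congrArg (fun x : ℤ => (x : ℂ)) (H n hn)
      push_cast at h
      rw [h, LSeries.convolution_def]
      simp only [Pi.one_apply, one_mul]
      rw [Nat.sum_divisorsAntidiagonal' (fun _ b : ℕ => χ (b : ZMod D))]
      congr 1
      exact Finset.sum_congr rfl fun e he => (dzchi_apply D e).symm
  have hpart : ∀ z : ℤ × ℤ, ∃! n : ℕ, z ∈ dzrep k n := by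
    intro z
    refine ⟨(dzq k z).toNat, ?_, ?_⟩
    · show dzq k z = _
      rw [Int.toNat_of_nonneg (dzq_nonneg (by omega) z)]
    · intro n hn
      have hn : dzq k z = n := hn
      simp [hn]
  have hfib : ∀ n : ℕ, ∀ z : dzrep k n, (dzq k z : ℂ) ^ (-s) = (n : ℂ) ^ (-s) := by
    rintro n ⟨z, hz⟩
    have hn : dzq k z = n := hz
    simp [hn]
  have hsum : Summable (fun z : ℤ × ℤ => ((dzq k z : ℤ) : ℂ) ^ (-s)) := by
    apply Summable.of_norm
    rw [summable_partition (fun _ => norm_nonneg _) hpart]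
    refine ⟨fun n => ?_, ?_⟩
    · have := (dzrep_finite (by omega : 1 ≤ k) n).to_subtype
      exact Summable.of_finite
    · have h1 := ((hL.summable.mul_left 2).congr fun n => (hterm n).symm).norm
      refine h1.congr fun n => ?_
      simp_rw [hfib, tsum_const, Nat.card_coe_set_eq]
      simp
  refine ⟨hsum, ?_⟩
  have h2 := (Set.sigmaEquiv _ hpart).tsum_eq (fun z : ℤ × ℤ => ((dzq k z : ℤ) : ℂ) ^ (-s))
  rw [← h2]
  refine (Summable.tsum_sigma ((Set.sigmaEquiv _ hpart).summable_iff.2 hsum)).trans ?_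
  have h3 : ∀ n : ℕ, ∑' c : dzrep k n, (dzq k ((Set.sigmaEquiv _ hpart) ⟨n, c⟩) : ℂ) ^ (-s) =
      2 * LSeries.term (LSeries.convolution (1 : ℕ → ℂ) (fun n : ℕ => χ n)) s n := by
    intro n
    rw [← hterm]
    have : ∀ c : dzrep k n, (dzq k ((Set.sigmaEquiv _ hpart) ⟨n, c⟩) : ℂ) ^ (-s) = (n : ℂ) ^ (-s) :=
      fun c => hfib n c
    simp_rw [this, tsum_const, Nat.card_coe_set_eq]
    simp
  refine (tsum_congr h3).trans ?_
  rw [tsum_mul_left]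
  congr 1
  exact hL.tsum_eq
end

section
open MeasureTheory

theorem dz_cpow_sub_le {A B : ℝ} (hA : 0 < A) (hB : 0 < B) {s : ℂ} (hs : 0 < s.re) :
    ‖(A : ℂ) ^ (-s) - (B : ℂ) ^ (-s)‖ ≤ ‖s‖ / s.re * |A ^ (-s.re) - B ^ (-s.re)| := by
  wlog hAB : A ≤ B generalizing A B
  · rw [norm_sub_rev, abs_sub_comm]
    exact this hB hA (by linarith)
  have hs0 : s ≠ 0 := by rintro rfl; simp at hs
  have h0 : (0 : ℝ) ∉ Set.uIcc A B := by
    rw [Set.uIcc_of_le hAB]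
    intro h
    linarith [h.1]
  have h1 := integral_cpow (a := A) (b := B) (r := -s - 1)
    (Or.inr ⟨fun h => hs0 (by linear_combination -h), h0⟩)
  have h2 := integral_rpow (a := A) (b := B) (r := -s.re - 1)
    (Or.inr ⟨fun h => hs.ne' (by linear_combination -h), h0⟩)
  rw [sub_add_cancel] at h1 h2
  have h3 : ‖∫ x : ℝ in A..B, (x : ℂ) ^ (-s - 1)‖ ≤ ∫ x in A..B, x ^ (-s.re - 1) := by
    refine (intervalIntegral.norm_integral_le_integral_norm hAB).trans (le_of_eq ?_)
    apply intervalIntegral.integral_congr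
    intro x hx
    rw [Set.uIcc_of_le hAB] at hx
    show ‖(x : ℂ) ^ (-s - 1)‖ = _
    rw [norm_cpow_eq_rpow_re_of_pos (by linarith [hx.1])]
    simp
  rw [h1, h2] at h3
  have h4 : B ^ (-s.re) ≤ A ^ (-s.re) :=
    Real.rpow_le_rpow_of_nonpos hA hAB (by linarith)
  rw [norm_div, norm_neg, div_le_iff₀ (norm_pos_iff.2 hs0)] at h3
  rw [norm_sub_rev, abs_of_nonneg (by linarith)]
  refine h3.trans (le_of_eq ?_)
  field_simp
  ring

theorem dz_sum_int (G : ℝ → ℂ) (h : ℝ → ℝ) (hG : Integrable G) (hGc : Continuous G) (c β : ℝ)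
    (hc : 0 ≤ c) (hh : ∀ t, 0 ≤ h t) (hm : ∀ t u, |t| ≤ |u| → h u ≤ h t)
    (hGh : ∀ t u, ‖G t - G u‖ ≤ c * |h t - h u|) :
    Summable (fun n : ℤ => G (n + β)) ∧
      ‖∑' n : ℤ, G (n + β) - ∫ t, G t‖ ≤ c * (2 * h 0) := by
  set V : ℝ → ℝ := fun t => if t ≤ 0 then h t else 2 * h 0 - h t with hV
  have h0 : ∀ t, h t ≤ h 0 := fun t => hm 0 t (by simp)
  have hV0 : ∀ t, 0 ≤ V t := by
    intro t
    simp only [hV]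
    split_ifs
    · exact hh t
    · linarith [h0 t, hh 0]
  have hV1 : ∀ t, V t ≤ 2 * h 0 := by
    intro t
    simp only [hV]
    split_ifs
    · linarith [h0 t, hh 0]
    · linarith [hh t]
  have hVm : ∀ t u, t ≤ u → |h t - h u| ≤ V u - V t := by
    intro t u htu
    simp only [hV]
    rw [abs_le]
    split_ifs with h1 h2 h2
    · have := hm u t (by rw [abs_of_nonpos h1, abs_of_nonpos h2]; linarith)
      constructor <;> linarith
    · linarith
    · constructor <;> linarith [h0 t, h0 u]
    · have := hm t u (by rw [abs_of_nonneg (by linarith), abs_of_nonneg (by linarith)]; linarith)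
      constructor <;> linarith
  have hVmono : Monotone V := fun t u htu => by
    have := (abs_nonneg _).trans (hVm t u htu)
    linarith
  set W : ℤ → ℝ := fun n => V (n + 1 + β) - V (n + β) with hW
  have hW0 : ∀ n, 0 ≤ W n := fun n => sub_nonneg.2 (hVmono (by linarith))
  have htel : ∀ N : ℕ, ∑ n ∈ Finset.Ico (-(N : ℤ)) N, W n = V (N + β) - V (-N + β) := by
    intro N
    have : ∀ a : ℤ, ∀ m : ℕ, ∑ n ∈ Finset.Ico a (a + m), W n = V (a + m + β) - V (a + β) := by
      intro a m
      induction m with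
      | zero => simp
      | succ m ih =>
        have e : Finset.Ico a (a + (m + 1 : ℕ)) = insert (a + m) (Finset.Ico a (a + m)) := by
          ext x
          simp only [Finset.mem_Ico, Finset.mem_insert]
          push_cast
          omega
        rw [e, Finset.sum_insert (by simp), ih]
        simp only [hW]
        push_cast
        ring_nf
    have h2 := this (-N) (2 * N)
    rw [show (-(N : ℤ) + (2 * N : ℕ)) = N by push_cast; ring] at h2
    rw [h2]
    push_cast
    ring_nf
  have hfin : ∀ S : Finset ℤ, ∑ n ∈ S, W n ≤ 2 * h 0 := by
    intro S
    obtain ⟨N, hN⟩ : ∃ N : ℕ, S ⊆ Finset.Ico (-(N : ℤ)) N := by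
      refine ⟨∑ x ∈ S, (x.natAbs + 1), fun x hx => ?_⟩
      have := Finset.single_le_sum (f := fun x : ℤ => x.natAbs + 1) (fun _ _ => Nat.zero_le _) hx
      simp only [Finset.mem_Ico]
      omega
    refine (Finset.sum_le_sum_of_subset_of_nonneg hN fun i _ _ => hW0 i).trans ?_
    rw [htel]
    linarith [hV0 (-N + β), hV1 (N + β)]
  have hWs : Summable W := summable_of_sum_le hW0 hfin
  have hWt : ∑' n, W n ≤ 2 * h 0 := hWs.tsum_le_of_sum_le hfin
  have hI := (hG.comp_add_right β).hasSum_intervalIntegral_comp_add_int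
  rw [integral_add_right_eq_self G β] at hI
  have hbd : ∀ n : ℤ, ‖G (n + β) - ∫ x in (0 : ℝ)..1, G (x + n + β)‖ ≤ c * W n := by
    intro n
    have e : G (n + β) - ∫ x in (0 : ℝ)..1, G (x + n + β) =
        ∫ x in (0 : ℝ)..1, (G (n + β) - G (x + n + β)) := by
      rw [intervalIntegral.integral_sub]
      · simp
      · simp
      · exact (by fun_prop : Continuous fun x : ℝ => G (x + n + β)).intervalIntegrable _ _
    rw [e]
    have := intervalIntegral.norm_integral_le_of_norm_le_const (a := (0 : ℝ)) (b := 1)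
      (f := fun x => G (n + β) - G (x + n + β)) (C := c * W n) ?_
    · simpa using this
    · intro x hx
      rw [Set.uIoc_of_le zero_le_one] at hx
      refine (hGh _ _).trans (mul_le_mul_of_nonneg_left ?_ hc)
      refine (hVm _ _ (by linarith [hx.1])).trans ?_
      simp only [hW]
      linarith [hVmono (by linarith [hx.2] : x + n + β ≤ n + 1 + β)]
  have hds : Summable (fun n : ℤ => G (n + β) - ∫ x in (0 : ℝ)..1, G (x + n + β)) :=
    Summable.of_norm_bounded (hWs.mul_left c) hbd
  have hGs : Summable (fun n : ℤ => G (n + β)) := by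
    simpa using hds.add hI.summable
  refine ⟨hGs, ?_⟩
  rw [← hI.tsum_eq, ← hGs.tsum_sub hI.summable]
  refine (tsum_of_norm_bounded (hWs.mul_left c).hasSum hbd).trans ?_
  rw [tsum_mul_left]
  exact mul_le_mul_of_nonneg_left hWt hc

noncomputable def dzC (s : ℂ) : ℂ := ∫ t : ℝ, ((1 + t ^ 2 : ℝ) : ℂ) ^ (-s)

theorem dz_int_real {σ : ℝ} (hσ : 1 / 2 < σ) : Integrable (fun t : ℝ => (1 + t ^ 2) ^ (-σ)) := by
  have := integrable_rpow_neg_one_add_norm_sq (E := ℝ) (μ := volume) (r := 2 * σ)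
    (by simp; linarith)
  refine this.congr (Filter.Eventually.of_forall fun t => ?_)
  show (1 + ‖t‖ ^ 2) ^ (-(2 * σ) / 2) = _
  rw [Real.norm_eq_abs, sq_abs]
  congr 1
  ring

theorem dz_cont {s : ℂ} {a : ℝ} (ha : 0 < a) :
    Continuous (fun t : ℝ => ((t ^ 2 + a ^ 2 : ℝ) : ℂ) ^ (-s)) := by
  rw [continuous_iff_continuousAt]
  intro t
  have h : ContinuousAt (fun t : ℝ => ((t ^ 2 + a ^ 2 : ℝ) : ℂ)) t := by fun_prop
  exact h.cpow continuousAt_const (Or.inl (by rw [ofReal_re]; positivity))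

theorem dz_int {s : ℂ} (hs : 1 / 2 < s.re) : Integrable (fun t : ℝ => ((1 + t ^ 2 : ℝ) : ℂ) ^ (-s)) := by
  refine (dz_int_real hs).mono' ?_ ?_
  · have := (dz_cont (s := s) (a := 1) one_pos).aestronglyMeasurable (μ := volume)
    simpa [add_comm] using this
  · refine Filter.Eventually.of_forall fun t => ?_
    rw [norm_cpow_eq_rpow_re_of_pos (by positivity)]
    simp

theorem dzC_diff {s : ℂ} (hs : 1 / 2 < s.re) : DifferentiableAt ℂ dzC s := by
  set ε : ℝ := (s.re - 1 / 2) / 4 with hε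
  have hε0 : 0 < ε := by rw [hε]; linarith
  have key := hasDerivAt_integral_of_dominated_loc_of_deriv_le (𝕜 := ℂ) (μ := (volume : Measure ℝ))
    (F := fun (z : ℂ) (t : ℝ) => ((1 + t ^ 2 : ℝ) : ℂ) ^ (-z))
    (F' := fun (z : ℂ) (t : ℝ) => ((1 + t ^ 2 : ℝ) : ℂ) ^ (-z) * Complex.log ((1 + t ^ 2 : ℝ) : ℂ) * (-1))
    (bound := fun t : ℝ => ε⁻¹ * (1 + t ^ 2) ^ (-(s.re - 2 * ε))) (x₀ := s)
    (s := Metric.ball s ε) (Metric.ball_mem_nhds s hε0) ?_ (dz_int hs) ?_ ?_ ?_ ?_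
  · exact key.2.differentiableAt
  · refine Filter.Eventually.of_forall fun z => ?_
    have := (dz_cont (s := z) (a := 1) one_pos).aestronglyMeasurable (μ := volume)
    simpa [add_comm] using this
  · have h1 := (dz_cont (s := s) (a := 1) one_pos)
    have h2 : Continuous fun t : ℝ => Complex.log ((t ^ 2 + 1 ^ 2 : ℝ) : ℂ) := by
      rw [continuous_iff_continuousAt]
      intro t
      have h : ContinuousAt (fun t : ℝ => ((t ^ 2 + 1 ^ 2 : ℝ) : ℂ)) t := by fun_prop
      exact h.clog (Or.inl (by rw [ofReal_re]; positivity))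
    have := ((h1.mul h2).mul (continuous_const (y := (-1 : ℂ)))).aestronglyMeasurable (μ := volume)
    refine this.congr (Filter.Eventually.of_forall fun t => ?_)
    simp [add_comm]
  · refine Filter.Eventually.of_forall fun t z hz => ?_
    have hp : (1 : ℝ) ≤ 1 + t ^ 2 := by nlinarith [sq_nonneg t]
    have hz1 : s.re - ε ≤ z.re := by
      have h1 : |(z - s).re| ≤ ‖z - s‖ := abs_re_le_norm _
      have h2 : ‖z - s‖ < ε := by simpa [dist_eq_norm] using hz
      have := (abs_le.1 (h1.trans h2.le)).1
      simp only [sub_re] at this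
      linarith
    rw [norm_mul, norm_mul, norm_cpow_eq_rpow_re_of_pos (by positivity), ← ofReal_log (by positivity)]
    simp only [neg_re, norm_neg, norm_one, mul_one, norm_real, Real.norm_eq_abs]
    rw [abs_of_nonneg (Real.log_nonneg hp)]
    have h3 : Real.log (1 + t ^ 2) ≤ (1 + t ^ 2) ^ ε / ε := Real.log_le_rpow_div (by positivity) hε0
    have h4 : (1 + t ^ 2) ^ (-z.re) ≤ (1 + t ^ 2) ^ (-(s.re - ε)) :=
      Real.rpow_le_rpow_of_exponent_le hp (by linarith)
    calc _ ≤ (1 + t ^ 2) ^ (-(s.re - ε)) * ((1 + t ^ 2) ^ ε / ε) :=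
          mul_le_mul h4 h3 (Real.log_nonneg hp) (by positivity)
      _ = _ := by
          rw [show -(s.re - 2 * ε) = -(s.re - ε) + ε by ring, Real.rpow_add (by positivity)]
          ring
  · exact (dz_int_real (by rw [hε]; linarith)).const_mul _
  · refine Filter.Eventually.of_forall fun t z hz => ?_
    have hne : ((1 + t ^ 2 : ℝ) : ℂ) ≠ 0 := by
      rw [ofReal_ne_zero]; positivity
    exact ((hasDerivAt_id z).neg).const_cpow (Or.inl hne)

theorem dz_scale {a : ℝ} (ha : 0 < a) (s : ℂ) (t : ℝ) : ((t ^ 2 + a ^ 2 : ℝ) : ℂ) ^ (-s) =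
    (a : ℂ) ^ (-2 * s) * ((1 + (t / a) ^ 2 : ℝ) : ℂ) ^ (-s) := by
  have h : t ^ 2 + a ^ 2 = a ^ 2 * (1 + (t / a) ^ 2) := by field_simp; ring
  rw [h, ofReal_mul, mul_cpow_ofReal_nonneg (by positivity) (by positivity)]
  congr 1
  rw [sq, ofReal_mul, mul_cpow_ofReal_nonneg ha.le ha.le, ← cpow_add _ _ (by simpa using ha.ne')]
  congr 1
  ring

theorem dz_T {a β : ℝ} (ha : 0 < a) {s : ℂ} (hs : 1 / 2 < s.re) :
    Summable (fun n : ℤ => (((n + β) ^ 2 + a ^ 2 : ℝ) : ℂ) ^ (-s)) ∧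
    ‖∑' n : ℤ, (((n + β) ^ 2 + a ^ 2 : ℝ) : ℂ) ^ (-s) - (a : ℂ) ^ (1 - 2 * s) * dzC s‖ ≤
      ‖s‖ / s.re * (2 * a ^ (-2 * s.re)) := by
  have hs0 : 0 < s.re := by linarith
  have hintG : Integrable (fun t : ℝ => ((t ^ 2 + a ^ 2 : ℝ) : ℂ) ^ (-s)) := by
    simp_rw [dz_scale ha s]
    exact ((dz_int hs).comp_div ha.ne').const_mul _
  have hval : ∫ t : ℝ, ((t ^ 2 + a ^ 2 : ℝ) : ℂ) ^ (-s) = (a : ℂ) ^ (1 - 2 * s) * dzC s := by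
    simp_rw [dz_scale ha s]
    rw [integral_const_mul, Measure.integral_comp_div (fun t : ℝ => ((1 + t ^ 2 : ℝ) : ℂ) ^ (-s)),
      abs_of_pos ha, ← dzC, sub_eq_add_neg, cpow_add _ _ (by simpa using ha.ne'), cpow_one,
      real_smul, neg_mul]
    ring
  have := dz_sum_int (fun t : ℝ => ((t ^ 2 + a ^ 2 : ℝ) : ℂ) ^ (-s))
    (fun t => (t ^ 2 + a ^ 2) ^ (-s.re)) hintG (dz_cont ha) (‖s‖ / s.re) β (by positivity)
    (fun t => by positivity)
    (fun t u htu => Real.rpow_le_rpow_of_nonpos (by positivity)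
      (by have := sq_le_sq.2 htu; linarith) (by linarith))
    (fun t u => dz_cpow_sub_le (by positivity) (by positivity) hs0)
  refine ⟨this.1, ?_⟩
  have h2 := this.2
  rw [hval] at h2
  refine h2.trans (le_of_eq ?_)
  congr 2
  rw [zero_pow two_ne_zero, zero_add, ← Real.rpow_natCast, ← Real.rpow_mul ha.le]
  congr 1
  push_cast
  ring
end

section

noncomputable def dzT (a β : ℝ) (s : ℂ) : ℂ := ∑' n : ℤ, (((n + β) ^ 2 + a ^ 2 : ℝ) : ℂ) ^ (-s)

theorem dzT_diff {a β : ℝ} (ha : 1 ≤ a) {s : ℂ} (hs : 1 / 2 < s.re) :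
    DifferentiableAt ℂ (dzT a β) s := by
  set σ : ℝ := (1 / 2 + s.re) / 2 with hσ
  have hσ1 : 1 / 2 < σ := by rw [hσ]; linarith
  have hσ2 : σ < s.re := by rw [hσ]; linarith
  have hpos : ∀ n : ℤ, (1 : ℝ) ≤ (n + β) ^ 2 + a ^ 2 := fun n => by
    nlinarith [sq_nonneg ((n : ℝ) + β)]
  have hU : IsOpen {z : ℂ | σ < z.re} := isOpen_lt continuous_const continuous_re
  have hsum := ((dz_T (a := a) (β := β) (by linarith) (s := (σ : ℂ)) (by simpa using hσ1)).1).norm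
  refine (differentiableOn_tsum_of_summable_norm hsum (U := {z : ℂ | σ < z.re}) ?_ hU ?_ s hσ2).differentiableAt
    (hU.mem_nhds hσ2)
  · intro n z hz
    apply DifferentiableAt.differentiableWithinAt
    have hne : (((n + β) ^ 2 + a ^ 2 : ℝ) : ℂ) ≠ 0 := by
      rw [ofReal_ne_zero]; linarith [hpos n]
    exact (((hasDerivAt_id z).neg).const_cpow (Or.inl hne)).differentiableAt
  · intro n z hz
    have hz : σ < z.re := hz
    rw [norm_cpow_eq_rpow_re_of_pos (by linarith [hpos n]),
      norm_cpow_eq_rpow_re_of_pos (by linarith [hpos n])]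
    exact Real.rpow_le_rpow_of_exponent_le (hpos n) (by simp; linarith)

noncomputable def dzE (a : ℝ) (s : ℂ) : ℂ :=
  ∑' y : ℕ+, (dzT (a * y) ((y : ℝ) / 2) s - ((a * y : ℝ) : ℂ) ^ (1 - 2 * s) * dzC s)

theorem dzE_term {a : ℝ} (ha : 0 < a) {s : ℂ} (hs : 1 / 2 < s.re) (y : ℕ+) :
    ‖dzT (a * y) ((y : ℝ) / 2) s - ((a * y : ℝ) : ℂ) ^ (1 - 2 * s) * dzC s‖ ≤
      ‖s‖ / s.re * (2 * (a * y) ^ (-2 * s.re)) := by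
  have hy : (0 : ℝ) < (y : ℝ) := by exact_mod_cast y.pos
  exact (dz_T (β := (y : ℝ) / 2) (by positivity : 0 < a * (y : ℝ)) hs).2

theorem dz_pnat_summable {σ : ℝ} (hσ : 1 / 2 < σ) :
    Summable (fun y : ℕ+ => ((y : ℕ) : ℝ) ^ (-2 * σ)) :=
  (Real.summable_nat_rpow.2 (by linarith)).comp_injective PNat.coe_injective

theorem dz_pnat_summable' {a σ : ℝ} (ha : 0 < a) (hσ : 1 / 2 < σ) (c : ℝ) :
    HasSum (fun y : ℕ+ => c * (2 * (a * y) ^ (-2 * σ)))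
      (c * 2 * (∑' y : ℕ+, ((y : ℕ) : ℝ) ^ (-2 * σ)) * a ^ (-2 * σ)) := by
  have := ((dz_pnat_summable hσ).hasSum.mul_left (c * 2)).mul_right (a ^ (-2 * σ))
  suffices e : (fun y : ℕ+ => c * (2 * (a * y) ^ (-2 * σ))) =
      fun y : ℕ+ => c * 2 * ((y : ℕ) : ℝ) ^ (-2 * σ) * a ^ (-2 * σ) by
    rw [e]; exact this
  funext y
  rw [Real.mul_rpow ha.le (by positivity)]
  ring

theorem dzE_le {a : ℝ} (ha : 0 < a) {s : ℂ} (hs : 1 / 2 < s.re) :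
    ‖dzE a s‖ ≤ ‖s‖ / s.re * 2 * (∑' y : ℕ+, ((y : ℕ) : ℝ) ^ (-2 * s.re)) * a ^ (-2 * s.re) :=
  tsum_of_norm_bounded (dz_pnat_summable' ha hs _) (dzE_term ha hs)

theorem dzE_diff {a : ℝ} (ha : 1 ≤ a) {s : ℂ} (hs : 1 / 2 < s.re) :
    DifferentiableAt ℂ (dzE a) s := by
  set σ : ℝ := (1 / 2 + s.re) / 2 with hσ
  have hσ1 : 1 / 2 < σ := by rw [hσ]; linarith
  have hσ2 : σ < s.re := by rw [hσ]; linarith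
  have hU : IsOpen ({z : ℂ | σ < z.re} ∩ Metric.ball 0 (‖s‖ + 1)) :=
    (isOpen_lt continuous_const continuous_re).inter Metric.isOpen_ball
  have hsU : s ∈ {z : ℂ | σ < z.re} ∩ Metric.ball 0 (‖s‖ + 1) := ⟨hσ2, by simp⟩
  have ha0 : 0 < a := by linarith
  have hy : ∀ y : ℕ+, (1 : ℝ) ≤ (y : ℝ) := fun y => by exact_mod_cast y.pos
  have hay : ∀ y : ℕ+, (1 : ℝ) ≤ a * y := fun y => by nlinarith [hy y]
  refine (differentiableOn_tsum_of_summable_norm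
    (dz_pnat_summable' ha0 hσ1 ((‖s‖ + 1) / σ)).summable ?_ hU ?_ s hsU).differentiableAt
    (hU.mem_nhds hsU)
  · rintro y z ⟨hz, -⟩
    have hz : σ < z.re := hz
    apply DifferentiableAt.differentiableWithinAt
    have hne : ((a * y : ℝ) : ℂ) ≠ 0 := by
      rw [ofReal_ne_zero]; linarith [hay y]
    apply (dzT_diff (hay y) (by linarith)).sub
    apply DifferentiableAt.mul _ (dzC_diff (by linarith))
    exact DifferentiableAt.const_cpow (by fun_prop) (Or.inl hne)
  · rintro y z ⟨hz, hz2⟩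
    have hz : σ < z.re := hz
    have hz2 : ‖z‖ < ‖s‖ + 1 := by simpa using hz2
    refine (dzE_term ha0 (by linarith) y).trans ?_
    have h1 : ‖z‖ / z.re ≤ (‖s‖ + 1) / σ :=
      div_le_div₀ (by positivity) hz2.le (by linarith) hz.le
    have h2 : (a * y) ^ (-2 * z.re) ≤ (a * y) ^ (-2 * σ) :=
      Real.rpow_le_rpow_of_exponent_le (hay y) (by linarith)
    have h3 : 0 ≤ (a * y) ^ (-2 * z.re) := Real.rpow_nonneg (by linarith [hay y]) _
    have h4 : 0 ≤ (‖s‖ + 1) / σ := div_nonneg (by positivity) (by linarith)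
    exact mul_le_mul h1 (by linarith) (by positivity) h4

theorem dz_zeta_pnat {s : ℂ} (hs : 1 < s.re) :
    HasSum (fun y : ℕ+ => ((y : ℕ) : ℂ) ^ (-s)) (riemannZeta s) := by
  have hsum : Summable (fun y : ℕ+ => ((y : ℕ) : ℂ) ^ (-s)) := by
    have := (Complex.summable_one_div_nat_cpow.2 hs).comp_injective PNat.coe_injective
    simpa [Function.comp_def, cpow_neg] using this
  have : riemannZeta s = ∑' y : ℕ+, ((y : ℕ) : ℂ) ^ (-s) := by
    rw [zeta_eq_tsum_one_div_nat_add_one_cpow hs, tsum_pnat_eq_tsum_succ (f := fun n : ℕ => (n : ℂ) ^ (-s))]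
    simp [cpow_neg]
  rw [this]
  exact hsum.hasSum

theorem dz_main {k : ℤ} (hk : 2 ≤ k) {a : ℝ} (ha : 0 < a) (hak : a ^ 2 = k - 1 / 4) {s : ℂ}
    (hs : 1 < s.re) (hsum : Summable (fun z : ℤ × ℤ => ((dzq k z : ℤ) : ℂ) ^ (-s))) :
    ∑' z : ℤ × ℤ, ((dzq k z : ℤ) : ℂ) ^ (-s) =
      2 * (riemannZeta (2 * s) + (a : ℂ) ^ (1 - 2 * s) * riemannZeta (2 * s - 1) * dzC s +
        dzE a s) := by
  have hs0 : s ≠ 0 := by rintro rfl; simp at hs; linarith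
  have hs2 : 1 < (2 * s).re := by simp; linarith
  have hs3 : 1 < (2 * s - 1).re := by simp; linarith
  have hsum' : Summable (fun z : ℤ × ℤ => ((dzq k (z.2, z.1) : ℤ) : ℂ) ^ (-s)) :=
    (Equiv.prodComm ℤ ℤ).summable_iff.2 hsum
  have h1 : ∑' z : ℤ × ℤ, ((dzq k z : ℤ) : ℂ) ^ (-s) =
      ∑' y : ℤ, ∑' x : ℤ, ((dzq k (x, y) : ℤ) : ℂ) ^ (-s) := by
    rw [← hsum'.tsum_prod]
    exact ((Equiv.prodComm ℤ ℤ).tsum_eq (fun z : ℤ × ℤ => ((dzq k z : ℤ) : ℂ) ^ (-s))).symm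
  have hzero : ∑' x : ℤ, ((dzq k (x, 0) : ℤ) : ℂ) ^ (-s) = 2 * riemannZeta (2 * s) := by
    have hsumx := hsum'.prod_factor 0
    rw [tsum_int_eq_zero_add_two_mul_tsum_pnat (fun x => by simp [dzq]) hsumx, two_nsmul, ← two_mul,
      ← (dz_zeta_pnat hs2).tsum_eq]
    simp only [dzq]
    simp [hs0]
    refine tsum_congr fun y => ?_
    rw [sq, natCast_mul_natCast_cpow, ← cpow_add _ _ (by simp)]
    congr 1
    ring
  have hT : ∀ y : ℕ+, ∑' x : ℤ, ((dzq k (x, ((y : ℕ) : ℤ)) : ℤ) : ℂ) ^ (-s) =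
      dzT (a * y) ((y : ℝ) / 2) s := by
    intro y
    refine tsum_congr fun x => ?_
    congr 1
    rw [← ofReal_intCast]
    congr 1
    simp only [dzq]
    push_cast
    rw [mul_pow, hak]
    ring
  rw [h1, tsum_int_eq_zero_add_two_mul_tsum_pnat ?_ hsum'.prod, hzero, two_nsmul, ← two_mul]
  · simp_rw [hT]
    have hE : Summable (fun y : ℕ+ => dzT (a * y) ((y : ℝ) / 2) s -
        ((a * y : ℝ) : ℂ) ^ (1 - 2 * s) * dzC s) :=
      Summable.of_norm_bounded (dz_pnat_summable' ha (by linarith) _).summable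
        (dzE_term ha (by linarith))
    have hZ : HasSum (fun y : ℕ+ => ((a * y : ℝ) : ℂ) ^ (1 - 2 * s) * dzC s)
        ((a : ℂ) ^ (1 - 2 * s) * riemannZeta (2 * s - 1) * dzC s) := by
      have := ((dz_zeta_pnat hs3).mul_left ((a : ℂ) ^ (1 - 2 * s))).mul_right (dzC s)
      suffices e : (fun y : ℕ+ => ((a * y : ℝ) : ℂ) ^ (1 - 2 * s) * dzC s) =
          fun y : ℕ+ => (a : ℂ) ^ (1 - 2 * s) * ((y : ℕ) : ℂ) ^ (-(2 * s - 1)) * dzC s by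
        rw [e]; exact this
      funext y
      rw [ofReal_mul, mul_cpow_ofReal_nonneg ha.le (by positivity),
        show -(2 * s - 1) = 1 - 2 * s by ring, ofReal_natCast]
    have h5 := (hE.hasSum.add hZ).tsum_eq
    simp only [sub_add_cancel] at h5
    rw [h5, ← dzE]
    ring
  · intro y
    show ∑' x : ℤ, ((dzq k (x, -y) : ℤ) : ℂ) ^ (-s) = ∑' x : ℤ, ((dzq k (x, y) : ℤ) : ℂ) ^ (-s)
    rw [← (Equiv.neg ℤ).tsum_eq]
    refine tsum_congr fun x => ?_
    simp [dzq]
end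

section
open scoped NumberTheorySymbols

theorem dz_zero {D : ℕ} [NeZero D] {k : ℤ} (hk : 2 ≤ k) (hDk : (D : ℤ) = 4 * k - 1)
    (H : ∀ n : ℕ, n ≠ 0 → ((dzrep k n).ncard : ℤ) = 2 * ∑ e ∈ n.divisors, J((e : ℤ) | D))
    {a : ℝ} (ha : 1 ≤ a) (haD : 4 * a ^ 2 = D) {ρ : ℂ} (h0 : riemannZeta ρ = 0)
    (h1 : 1 / 2 < ρ.re) (h2 : ρ.re < 1) :
    riemannZeta (2 * ρ) + (a : ℂ) ^ (1 - 2 * ρ) * riemannZeta (2 * ρ - 1) * dzC ρ + dzE a ρ = 0 := by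
  have hak : a ^ 2 = k - 1 / 4 := by
    have : (D : ℝ) = 4 * k - 1 := by exact_mod_cast hDk
    linarith
  set M : ℝ := (|ρ.im| + 1) / (1 - ρ.re) with hM
  have hM1 : M * (ρ.re - 1) = -(|ρ.im| + 1) := by
    have : (1 - ρ.re) ≠ 0 := by linarith
    rw [hM]
    field_simp
    ring
  set U : Set ℂ := {z : ℂ | 1 / 2 < z.re ∧ M * (z.re - 1) < z.im} with hU
  have hUo : IsOpen U := by
    apply IsOpen.inter
    · exact isOpen_lt continuous_const continuous_re
    · exact isOpen_lt (continuous_const.mul (continuous_re.sub continuous_const)) continuous_im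
  have hUc : Convex ℝ U := by
    rintro x ⟨hx1, hx2⟩ y ⟨hy1, hy2⟩ p q hp hq hpq
    have hp' : p = 1 - q := by linarith
    subst hp'
    refine ⟨?_, ?_⟩
    · simp only [add_re, real_smul, re_ofReal_mul]
      rcases hq.eq_or_lt with rfl | hq
      · linarith
      · nlinarith
    · simp only [add_re, add_im, real_smul, re_ofReal_mul, im_ofReal_mul]
      rcases hq.eq_or_lt with rfl | hq
      · linarith
      · nlinarith
  have hne : ∀ z ∈ U, z ≠ 1 := by
    rintro z ⟨-, hz⟩ rfl
    simp at hz
  have hρ : ρ ∈ U := ⟨h1, by rw [hM1]; linarith [neg_abs_le ρ.im]⟩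
  set z₀ : ℂ := ⟨2, M + 1⟩ with hz₀
  have hz₀U : z₀ ∈ U := ⟨by simp [hz₀]; norm_num, by simp [hz₀]; linarith⟩
  have hF : DifferentiableOn ℂ
      (fun z => riemannZeta z * DirichletCharacter.LFunction (dzchi D) z) U := by
    intro z hz
    exact ((differentiableAt_riemannZeta (hne z hz)).mul
      (DirichletCharacter.differentiableAt_LFunction _ z (.inl (hne z hz)))).differentiableWithinAt
  have hG : DifferentiableOn ℂ (fun z => riemannZeta (2 * z) +
      (a : ℂ) ^ (1 - 2 * z) * riemannZeta (2 * z - 1) * dzC z + dzE a z) U := by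
    intro z hz
    have hz1 := hz.1
    apply DifferentiableAt.differentiableWithinAt
    apply DifferentiableAt.add
    · apply DifferentiableAt.add
      · refine DifferentiableAt.comp z (g := riemannZeta) (f := fun z => 2 * z)
          (differentiableAt_riemannZeta ?_) (by fun_prop)
        intro h
        have := congrArg re h
        simp at this
        linarith
      · apply DifferentiableAt.mul _ (dzC_diff hz1)
        apply DifferentiableAt.mul
        · refine DifferentiableAt.const_cpow (by fun_prop) (Or.inl ?_)
          rw [ofReal_ne_zero]; linarith
        · refine DifferentiableAt.comp z (g := riemannZeta) (f := fun z => 2 * z - 1)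
            (differentiableAt_riemannZeta ?_) (by fun_prop)
          intro h
          exact hne z hz (by linear_combination h / 2)
    · exact dzE_diff ha hz1
  have heq := (hF.analyticOnNhd hUo).eqOn_of_preconnected_of_eventuallyEq (hG.analyticOnNhd hUo)
    hUc.isPreconnected hz₀U (by
      have : {z : ℂ | 1 < z.re} ∈ nhds z₀ :=
        (isOpen_lt continuous_const continuous_re).mem_nhds (by simp [hz₀])
      filter_upwards [this] with z hz
      obtain ⟨e1, e2⟩ := dzq_cpow_summable hk H hz
      rw [dz_main hk (by linarith) hak hz e1] at e2
      exact (mul_left_cancel₀ two_ne_zero e2).symm)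
  have := heq hρ
  simp only [h0, zero_mul] at this
  exact this.symm

theorem dz_half (h : {d : ℤ | d < 0 ∧ Squarefree d ∧ ∀ (K : Type) [Field K] [NumberField K],
    Module.finrank ℚ K = 2 → (∃ α : K, α ^ 2 = (d : K)) → NumberField.classNumber K = 1}.Infinite)
    (ρ : ℂ) (h0 : riemannZeta ρ = 0) (h1 : 1 / 2 < ρ.re) (h2 : ρ.re < 1) : False := by
  set K₁ : ℝ := ‖riemannZeta (2 * ρ - 1)‖ * ‖dzC ρ‖ with hK₁
  set K₂ : ℝ := ‖ρ‖ / ρ.re * 2 * (∑' y : ℕ+, ((y : ℕ) : ℝ) ^ (-2 * ρ.re)) with hK₂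
  have hlim : Filter.Tendsto (fun a : ℝ => a ^ (-(2 * ρ.re - 1)) * K₁ + K₂ * a ^ (-(2 * ρ.re)))
      Filter.atTop (nhds (0 * K₁ + K₂ * 0)) :=
    ((tendsto_rpow_neg_atTop (by linarith)).mul_const K₁).add
      ((tendsto_rpow_neg_atTop (by linarith)).const_mul K₂)
  rw [zero_mul, mul_zero, add_zero] at hlim
  have hz : 0 < ‖riemannZeta (2 * ρ)‖ :=
    norm_pos_iff.2 (riemannZeta_ne_zero_of_one_le_re (by simp; linarith))
  obtain ⟨A, hA⟩ := Filter.eventually_atTop.1 (hlim.eventually_lt_const hz)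
  obtain ⟨N, hN⟩ := exists_nat_gt (4 * (max A 2) ^ 2)
  obtain ⟨d, ⟨hd0, hsq, hcl⟩, hdN⟩ : ∃ d ∈ {d : ℤ | d < 0 ∧ Squarefree d ∧
      ∀ (K : Type) [Field K] [NumberField K],
      Module.finrank ℚ K = 2 → (∃ α : K, α ^ 2 = (d : K)) → NumberField.classNumber K = 1},
      d < -(N : ℤ) := by
    by_contra! hcon
    refine h ((Set.finite_Icc (-(N : ℤ)) 0).subset fun d hd => ⟨hcon d hd, ?_⟩)
    exact (hd.1).le
  have hmax : (2 : ℝ) ≤ max A 2 := le_max_right _ _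
  have hN8 : (8 : ℝ) < N := by nlinarith
  have hN8' : 8 < N := by exact_mod_cast hN8
  obtain ⟨hd4, hrep⟩ := dz_class (by omega) hsq hcl
  obtain ⟨D, hD⟩ : ∃ D : ℕ, (D : ℤ) = -d := ⟨d.natAbs, by omega⟩
  obtain ⟨k, hk⟩ : ∃ k : ℤ, (D : ℤ) = 4 * k - 1 := ⟨(D + 1) / 4, by omega⟩
  obtain rfl : d = -(D : ℤ) := by omega
  have : NeZero D := ⟨by omega⟩
  have hk2 : 2 ≤ k := by omega
  have H := dz_rep_count hk hk2 hrep
  set a : ℝ := √(D : ℝ) / 2 with ha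
  have haD : 4 * a ^ 2 = D := by
    rw [ha, div_pow, Real.sq_sqrt (by positivity)]
    ring
  have ha0 : 0 ≤ a := by positivity
  have hDN : (N : ℝ) < D := by
    have : (N : ℤ) < D := by omega
    exact_mod_cast this
  have haA : max A 2 ≤ a := by
    by_contra! hlt
    nlinarith
  have ha1 : 1 ≤ a := by linarith
  have hzero := dz_zero hk2 hk H ha1 haD h0 h1 h2
  have hlt := hA a ((le_max_left _ _).trans haA)
  have hE := dzE_le (by linarith : 0 < a) h1
  have heq : riemannZeta (2 * ρ) =
      -((a : ℂ) ^ (1 - 2 * ρ) * riemannZeta (2 * ρ - 1) * dzC ρ + dzE a ρ) := by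
    linear_combination hzero
  have hn : ‖riemannZeta (2 * ρ)‖ ≤ a ^ (-(2 * ρ.re - 1)) * K₁ + K₂ * a ^ (-(2 * ρ.re)) := by
    rw [heq, norm_neg]
    refine (norm_add_le _ _).trans (add_le_add (le_of_eq ?_) ?_)
    · rw [norm_mul, norm_mul, norm_cpow_eq_rpow_re_of_pos (by linarith), hK₁, mul_assoc]
      congr 2
      simp
    · rw [hK₂, ← neg_mul]
      exact hE
  linarith

end


/-- Deuring: if there are infinitely many squarefree `d < 0` such that the
imaginary quadratic field `ℚ(√d)` has class number one, then the Riemann hypothesis holds. -/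
theorem deuring_class_number_one_implies_RH
    (h : {d : ℤ | d < 0 ∧ Squarefree d ∧
        ∀ (K : Type) [Field K] [NumberField K], Module.finrank ℚ K = 2 →
          (∃ α : K, α ^ 2 = (d : K)) → NumberField.classNumber K = 1}.Infinite) :
    ∀ ρ : ℂ, riemannZeta ρ = 0 → 0 < ρ.re → ρ.re < 1 → ρ.re = 1 / 2 := by
  intro ρ h0 h1 h2
  rcases lt_trichotomy ρ.re (1 / 2) with hlt | heq | hgt
  · exfalso
    refine dz_half h (1 - ρ) ?_ (by simp; linarith) (by simp; linarith)
    rw [riemannZeta_one_sub, h0, mul_zero]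
    · intro n hn
      have := congrArg re hn
      simp at this
      have h3 : (0 : ℝ) ≤ n := Nat.cast_nonneg n
      linarith
    · rintro rfl
      simp at h2
  · exact heq
  · exact (dz_half h ρ h0 hgt h2).elim
end
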